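/- arXiv:1304.0036 — 3 statements merged into one kernel-verified Lean document; each statement's English description precedes it below -/
import Mathlib

section
/- Let d ≥ 2 be an integer and let σ, ρ be probability vectors on Fin d. Set Δ = H(σ) - H(ρ). Then the relative entropy satisfies D(σ‖ρ) ≥ M(Δ, d) (an inequality in [0,∞]). -/
open scoped ENNReal BigOperators

noncomputable section

/-- Binary entropy (natural log), with Lean's convention `Real.log 0 = 0`. -/
def binEntropy' (x : ℝ) : ℝ := -(x * Real.log x) - (1 - x) * Real.log (1 - x)

/-- Binary relative entropy, valued in `[0,∞]`. -/
def binRelEntropy (x y : ℝ) : ℝ≥0∞ :=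
  if (y = 0 ∧ 0 < x) ∨ (y = 1 ∧ x < 1) then ⊤
  else ENNReal.ofReal (x * Real.log (x / y) + (1 - x) * Real.log ((1 - x) / (1 - y)))

/-- `M(Δ,d)`: infimum of binary relative entropies under the entropy-difference constraint. -/
def Mfun (Δ : ℝ) (d : ℕ) : ℝ≥0∞ :=
  sInf {m : ℝ≥0∞ | ∃ s r : ℝ, s ∈ Set.Icc (0:ℝ) (((d:ℝ) - 1) / d) ∧
    r ∈ Set.Icc (0:ℝ) (((d:ℝ) - 1) / d) ∧
    binEntropy' s - binEntropy' r + (s - r) * Real.log ((d:ℝ) - 1) = Δ ∧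
    m = binRelEntropy s r}

/-- Shannon entropy of a probability vector on `Fin d` (natural log). -/
def shEntropy {d : ℕ} (p : Fin d → ℝ) : ℝ := ∑ i, -(p i * Real.log (p i))

/-- Relative entropy between probability vectors on `Fin d`, valued in `[0,∞]`. -/
def relEntropy {d : ℕ} (p q : Fin d → ℝ) : ℝ≥0∞ :=
  if ∀ i, q i = 0 → p i = 0
  then ENNReal.ofReal (∑ i, p i * Real.log (p i / q i))
  else ⊤

/-- `N(d) = sup_{0<r<1/2} r(1-r) (log(((1-r)/r)(d-1)))²`. -/
def Nfun (d : ℕ) : ℝ :=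
  sSup {v : ℝ | ∃ r : ℝ, 0 < r ∧ r < 1/2 ∧
    v = r * (1 - r) * (Real.log ((1 - r) / r * ((d:ℝ) - 1)))^2}

/-- A convex function lies below its chord through two points between them, and above it outside. -/
lemma ConvexOn.exists_chord {g : ℝ → ℝ} (hg : ConvexOn ℝ Set.univ g) {u v : ℝ} (huv : u < v) :
    ∃ B C : ℝ, (∀ t ≤ u, B + C * t ≤ g t) ∧ (∀ t, u ≤ t → t ≤ v → g t ≤ B + C * t) ∧
      ∀ t, v ≤ t → B + C * t ≤ g t := by
  have hpos : 0 < v - u := sub_pos.2 huv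
  obtain ⟨C, hC⟩ : ∃ C : ℝ, C * (v - u) = g v - g u := ⟨(g v - g u) / (v - u), by field_simp⟩
  have key : ∀ t, (v - u) * (g u - C * u + C * t) = (v - t) * g u + (t - u) * g v := fun t => by
    linear_combination (t - u) * hC
  refine ⟨g u - C * u, C, fun t ht => ?_, fun t h1 h2 => ?_, fun t ht => ?_⟩
  · rcases ht.eq_or_lt with rfl | ht
    · linarith
    · refine le_of_mul_le_mul_left ?_ hpos
      have := hg.secant_mono_aux1 (Set.mem_univ t) (Set.mem_univ v) ht huv
      linarith [key t]
  · rcases h1.eq_or_lt with rfl | h1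
    · linarith
    rcases h2.eq_or_lt with rfl | h2
    · linarith
    · refine le_of_mul_le_mul_left ?_ hpos
      have := hg.secant_mono_aux1 (Set.mem_univ u) (Set.mem_univ v) h1 h2
      linarith [key t]
  · rcases ht.eq_or_lt with rfl | ht
    · linarith
    · refine le_of_mul_le_mul_left ?_ hpos
      have := hg.secant_mono_aux1 (Set.mem_univ u) (Set.mem_univ t) huv ht
      linarith [key t]

/-- Among vectors with given sum and given entropy, `∑ φ (ρ i)` is maximal at the vector with one
large entry `a` and all others equal to `b`, provided the derivative of `φ` is a convex
function of `log`. -/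
lemma sum_le_of_deriv_convex_log {d : ℕ} {ρ : Fin d → ℝ} {a b : ℝ} (j : Fin d)
    (hρ0 : ∀ i, 0 ≤ ρ i) (hj : ∀ i, ρ i ≤ ρ j) (hb : 0 < b) (hbj : b < ρ j) (hja : ρ j ≤ a)
    (hsum : ∑ i, ρ i = a + (d - 1) * b)
    (hent : ∑ i, ρ i * Real.log (ρ i) = a * Real.log a + (d - 1) * (b * Real.log b))
    {φ g : ℝ → ℝ} (hg : ConvexOn ℝ Set.univ g) (hφ : Continuous φ)
    (hφ' : ∀ x, 0 < x → HasDerivAt φ (g (Real.log x)) x) :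
    ∑ i, φ (ρ i) ≤ φ a + (d - 1) * φ b := by
  obtain ⟨B, C, h1, h2, h3⟩ := hg.exists_chord (Real.log_lt_log hb hbj)
  set ψ : ℝ → ℝ := fun x => φ x - ((B - C) * x + C * (x * Real.log x)) with hψ
  have hcont : Continuous ψ := by
    have := Real.continuous_mul_log
    fun_prop
  have hder : ∀ x, 0 < x → HasDerivAt ψ (g (Real.log x) - (B + C * Real.log x)) x := by
    intro x hx
    have := (hφ' x hx).sub (((hasDerivAt_id x).const_mul (B - C)).add
      ((Real.hasDerivAt_mul_log hx.ne').const_mul C))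
    convert! this using 1
    ring
  have hpeak : ∀ x, 0 ≤ x → x ≤ ρ j → ψ x ≤ ψ b := by
    intro x hx0 hxj
    rcases le_total x b with hxb | hbx
    · refine monotoneOn_of_hasDerivWithinAt_nonneg (convex_Icc x b) hcont.continuousOn
        (f' := fun x => g (Real.log x) - (B + C * Real.log x)) ?_ ?_
        (Set.left_mem_Icc.2 hxb) (Set.right_mem_Icc.2 hxb) hxb
      all_goals
        intro y hy
        rw [interior_Icc] at hy
        have hy0 : 0 < y := hx0.trans_lt hy.1
      · exact (hder y hy0).hasDerivWithinAt
      · exact sub_nonneg.2 (h1 _ (Real.log_le_log hy0 hy.2.le))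
    · refine antitoneOn_of_hasDerivWithinAt_nonpos (convex_Icc b x) hcont.continuousOn
        (f' := fun x => g (Real.log x) - (B + C * Real.log x)) ?_ ?_
        (Set.left_mem_Icc.2 hbx) (Set.right_mem_Icc.2 hbx) hbx
      all_goals
        intro y hy
        rw [interior_Icc] at hy
        have hy0 : 0 < y := hb.trans hy.1
      · exact (hder y hy0).hasDerivWithinAt
      · exact sub_nonpos.2 (h2 _ (Real.log_le_log hb hy.1.le)
          (Real.log_le_log hy0 (hy.2.le.trans hxj)))
  have htop : ψ (ρ j) ≤ ψ a := by
    refine monotoneOn_of_hasDerivWithinAt_nonneg (convex_Icc (ρ j) a) hcont.continuousOn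
      (f' := fun x => g (Real.log x) - (B + C * Real.log x)) ?_ ?_
      (Set.left_mem_Icc.2 hja) (Set.right_mem_Icc.2 hja) hja
    all_goals
      intro y hy
      rw [interior_Icc] at hy
      have hy0 : 0 < y := (hb.trans hbj).trans hy.1
    · exact (hder y hy0).hasDerivWithinAt
    · exact sub_nonneg.2 (h3 _ (Real.log_le_log (hb.trans hbj) hy.1.le))
  have hψsum : ∑ i, ψ (ρ i) ≤ ψ a + (d - 1) * ψ b := by
    have : ∑ i, (ψ (ρ i) - ψ b) ≤ ψ (ρ j) - ψ b := by
      rw [← Finset.add_sum_erase _ _ (Finset.mem_univ j)]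
      have : ∑ i ∈ Finset.univ.erase j, (ψ (ρ i) - ψ b) ≤ 0 :=
        Finset.sum_nonpos fun i _ => sub_nonpos.2 (hpeak _ (hρ0 i) (hj i))
      linarith
    rw [Finset.sum_sub_distrib, Finset.sum_const, Finset.card_univ, Fintype.card_fin,
      nsmul_eq_mul] at this
    linarith
  have hexp : ∑ i, ψ (ρ i) = ∑ i, φ (ρ i) - ((B - C) * ∑ i, ρ i +
      C * ∑ i, ρ i * Real.log (ρ i)) := by
    simp only [hψ, Finset.sum_sub_distrib, Finset.sum_add_distrib, Finset.mul_sum]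
  rw [hexp, hsum, hent] at hψsum
  simp only [hψ] at hψsum
  linarith

/-- Power sums under an entropy constraint are maximal at the vector with one large entry. -/
lemma sum_rpow_le {d : ℕ} {ρ : Fin d → ℝ} {a b : ℝ} (j : Fin d)
    (hρ0 : ∀ i, 0 ≤ ρ i) (hj : ∀ i, ρ i ≤ ρ j) (hb : 0 < b) (hbj : b < ρ j) (hja : ρ j ≤ a)
    (hsum : ∑ i, ρ i = a + (d - 1) * b)
    (hent : ∑ i, ρ i * Real.log (ρ i) = a * Real.log a + (d - 1) * (b * Real.log b))
    {β : ℝ} (hβ : 0 < β) :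
    ∑ i, ρ i ^ β ≤ a ^ β + (d - 1) * b ^ β := by
  have hg : ConvexOn ℝ Set.univ fun t : ℝ => β * Real.exp ((β - 1) * t) := by
    have := (convexOn_exp.comp_linearMap (LinearMap.mul ℝ ℝ (β - 1))).smul hβ.le
    simpa [sub_mul] using! this
  refine sum_le_of_deriv_convex_log j hρ0 hj hb hbj hja hsum hent (φ := fun x => x ^ β) hg
    (Real.continuous_rpow_const hβ.le) fun x hx => ?_
  convert! Real.hasDerivAt_rpow_const (p := β) (Or.inl hx.ne') using 1
  rw [Real.rpow_def_of_pos hx, mul_comm (β - 1)]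

/-- The Gibbs inequality. -/
lemma shEntropy_le_cross {d : ℕ} {σ τ : Fin d → ℝ} (hσ0 : ∀ i, 0 ≤ σ i) (hσ1 : ∑ i, σ i = 1)
    (hτ0 : ∀ i, 0 ≤ τ i) (hτ1 : ∑ i, τ i ≤ 1) (hac : ∀ i, τ i = 0 → σ i = 0) :
    shEntropy σ ≤ -∑ i, σ i * Real.log (τ i) := by
  have key : ∀ i, -(σ i * Real.log (σ i)) ≤ -(σ i * Real.log (τ i)) + (τ i - σ i) := by
    intro i
    rcases (hσ0 i).eq_or_lt with h | h
    · simp [← h, hτ0 i]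
    have ht : 0 < τ i := (hτ0 i).lt_of_ne fun h0 => h.ne' (hac i h0.symm)
    have := mul_le_mul_of_nonneg_left (Real.log_le_sub_one_of_pos (div_pos ht h)) h.le
    rw [Real.log_div ht.ne' h.ne', mul_sub, mul_sub, mul_div_cancel₀ _ h.ne'] at this
    linarith
  have := Finset.sum_le_sum fun i (_ : i ∈ Finset.univ) => key i
  rw [Finset.sum_add_distrib, Finset.sum_sub_distrib, Finset.sum_neg_distrib] at this
  rw [shEntropy, Finset.sum_neg_distrib]
  rw [Finset.sum_neg_distrib] at this
  linarith

lemma shEntropy_nonneg {d : ℕ} {σ : Fin d → ℝ} (hσ0 : ∀ i, 0 ≤ σ i) (hσ1 : ∑ i, σ i = 1) :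
    0 ≤ shEntropy σ := by
  refine Finset.sum_nonneg fun i _ => neg_nonneg.2 (Real.mul_log_nonpos (hσ0 i) ?_)
  rw [← hσ1]
  exact Finset.single_le_sum (fun i _ => hσ0 i) (Finset.mem_univ i)

lemma shEntropy_le_log {d : ℕ} (hd : 2 ≤ d) {σ : Fin d → ℝ} (hσ0 : ∀ i, 0 ≤ σ i)
    (hσ1 : ∑ i, σ i = 1) : shEntropy σ ≤ Real.log d := by
  have hd0 : (0 : ℝ) < d := by positivity
  have := shEntropy_le_cross (τ := fun _ => (d : ℝ)⁻¹) hσ0 hσ1 (fun _ => by positivity)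
    (by simp [hd0.ne']) (fun i h => absurd h (by positivity))
  simpa [← Finset.sum_mul, hσ1] using this

lemma qaryEntropy_eq (d : ℕ) (x : ℝ) :
    Real.qaryEntropy d x = binEntropy' x + x * Real.log ((d : ℝ) - 1) := by
  simp only [Real.qaryEntropy, Real.binEntropy, binEntropy', Real.log_inv]
  push_cast
  ring

lemma qaryEntropy_eq_mul_log {d : ℕ} (hd : 2 ≤ d) (x : ℝ) : Real.qaryEntropy d x =
    -((1 - x) * Real.log (1 - x) + x * Real.log (x / ((d : ℝ) - 1))) := by
  have hd' : (2 : ℝ) ≤ d := by exact_mod_cast hd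
  rw [qaryEntropy_eq, binEntropy']
  rcases eq_or_ne x 0 with rfl | hx
  · simp
  rw [Real.log_div hx (by linarith)]
  ring

/-- The Fano inequality: entropy bounded in terms of a single entry. -/
lemma shEntropy_le_qaryEntropy {d : ℕ} (hd : 2 ≤ d) {ρ : Fin d → ℝ} (hρ0 : ∀ i, 0 ≤ ρ i)
    (hρ1 : ∑ i, ρ i = 1) (j : Fin d) (hj0 : 0 < ρ j) :
    shEntropy ρ ≤ Real.qaryEntropy d (1 - ρ j) := by
  have hd' : (2 : ℝ) ≤ d := by exact_mod_cast hd
  have hsplit := Finset.add_sum_erase Finset.univ ρ (Finset.mem_univ j)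
  have hj1 : ρ j ≤ 1 := hρ1 ▸ Finset.single_le_sum (fun i _ => hρ0 i) (Finset.mem_univ j)
  have hcard : ((Finset.univ.erase j).card : ℝ) = d - 1 := by
    rw [Finset.card_erase_of_mem (Finset.mem_univ j), Finset.card_univ, Fintype.card_fin,
      Nat.cast_pred (by omega)]
  have hsum : ∀ (f : Fin d → ℝ) (c : ℝ → ℝ → ℝ) (u v : ℝ),
      ∑ i, c (f i) (if i = j then u else v) =
        c (f j) u + ∑ i ∈ Finset.univ.erase j, c (f i) v := by
    intro f c u v
    rw [← Finset.add_sum_erase _ _ (Finset.mem_univ j), if_pos rfl]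
    congr 1
    exact Finset.sum_congr rfl fun i hi => by rw [if_neg (Finset.ne_of_mem_erase hi)]
  have h := shEntropy_le_cross (τ := fun i => if i = j then ρ j else (1 - ρ j) / ((d : ℝ) - 1))
    hρ0 hρ1 ?_ ?_ ?_
  · rw [hsum ρ (fun x y => x * Real.log y), ← Finset.sum_mul] at h
    rw [qaryEntropy_eq_mul_log hd, sub_sub_cancel]
    rwa [show ∑ i ∈ Finset.univ.erase j, ρ i = 1 - ρ j by linarith] at h
  · intro i
    split_ifs
    · exact hj0.le
    · exact div_nonneg (by linarith) (by linarith)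
  · rw [hsum ρ (fun _ y => y), Finset.sum_const, nsmul_eq_mul, hcard,
      mul_div_cancel₀ _ (by linarith)]
    linarith
  · intro i hi
    split_ifs at hi with hij
    · rw [hij]; exact hi
    · have h0 : 1 - ρ j = 0 := by
        rcases div_eq_zero_iff.1 hi with h | h <;> linarith
      have := Finset.single_le_sum (f := ρ) (fun i _ => hρ0 i)
        (Finset.mem_erase.2 ⟨hij, Finset.mem_univ i⟩)
      linarith [hρ0 i]

/-- Every entropy value is attained by a vector with one large entry and the others equal. -/
lemma exists_qaryEntropy_eq {d : ℕ} (hd : 2 ≤ d) {h : ℝ} (h0 : 0 ≤ h) (h1 : h ≤ Real.log d) :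
    ∃ s ∈ Set.Icc (0 : ℝ) (((d : ℝ) - 1) / d), Real.qaryEntropy d s = h := by
  have hd' : (2 : ℝ) ≤ d := by exact_mod_cast hd
  have hle : (0 : ℝ) ≤ ((d : ℝ) - 1) / d := div_nonneg (by linarith) (by linarith)
  refine intermediate_value_Icc hle Real.qaryEntropy_continuous.continuousOn ⟨by simpa, ?_⟩
  rw [qaryEntropy_eq_mul_log hd, show 1 - ((d : ℝ) - 1) / d = (d : ℝ)⁻¹ by field_simp; ring,
    show ((d : ℝ) - 1) / d / (d - 1) = (d : ℝ)⁻¹ by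
      have : (d : ℝ) - 1 ≠ 0 := by linarith
      field_simp, ← add_mul,
    show (d : ℝ)⁻¹ + ((d : ℝ) - 1) / d = 1 by field_simp; ring, Real.log_inv]
  linarith

/-- Cross entropy bound for prescribed entropies, in terms of the vectors with one large entry
`1 - s`, `1 - r` and all other entries equal. -/
lemma sum_mul_log_le {d : ℕ} (hd : 2 ≤ d) {σ ρ : Fin d → ℝ}
    (hσ0 : ∀ i, 0 ≤ σ i) (hσ1 : ∑ i, σ i = 1) (hρ0 : ∀ i, 0 ≤ ρ i) (hρ1 : ∑ i, ρ i = 1)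
    (hac : ∀ i, ρ i = 0 → σ i = 0) {s r : ℝ} (hs : s ∈ Set.Icc (0 : ℝ) (((d : ℝ) - 1) / d))
    (hr : r ∈ Set.Icc (0 : ℝ) (((d : ℝ) - 1) / d)) (hr0 : 0 < r)
    (hsσ : Real.qaryEntropy d s = shEntropy σ) (hrρ : Real.qaryEntropy d r = shEntropy ρ) :
    ∑ i, σ i * Real.log (ρ i) ≤ (1 - s) * Real.log (1 - r) + s * Real.log (r / ((d : ℝ) - 1)) := by
  have hd' : (2 : ℝ) ≤ d := by exact_mod_cast hd
  have hd1 : (0 : ℝ) < d - 1 := by linarith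
  have hd0 : (0 : ℝ) < d := by linarith
  have : Nonempty (Fin d) := ⟨⟨0, by omega⟩⟩
  obtain ⟨j, hj⟩ := Finite.exists_max ρ
  have hIcc : ((d : ℝ) - 1) / d = 1 - 1 / d := by field_simp
  have hjd : 1 / (d : ℝ) ≤ ρ j := by
    rw [div_le_iff₀ hd0]
    have := Finset.sum_le_sum fun i (_ : i ∈ Finset.univ) => hj i
    rw [hρ1, Finset.sum_const, Finset.card_univ, Fintype.card_fin, nsmul_eq_mul] at this
    linarith
  have hj0 : 0 < ρ j := lt_of_lt_of_le (by positivity) hjd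
  have hj1 : ρ j ≤ 1 := hρ1 ▸ Finset.single_le_sum (fun i _ => hρ0 i) (Finset.mem_univ j)
  rw [hIcc] at hs hr
  have hja : ρ j ≤ 1 - r := by
    have h := shEntropy_le_qaryEntropy hd hρ0 hρ1 j hj0
    rw [← hrρ] at h
    have := ((Real.qaryEntropy_strictMonoOn hd).le_iff_le hr ⟨by linarith, by linarith⟩).1 h
    linarith
  have hlog_a : ∑ i, σ i * Real.log (ρ i) ≤ Real.log (1 - r) := by
    calc ∑ i, σ i * Real.log (ρ i) ≤ ∑ i, σ i * Real.log (1 - r) := by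
          refine Finset.sum_le_sum fun i _ => ?_
          rcases (hρ0 i).eq_or_lt with h | h
          · simp [hac i h.symm]
          · exact mul_le_mul_of_nonneg_left
              (Real.log_le_log h ((hj i).trans hja)) (hσ0 i)
      _ = Real.log (1 - r) := by rw [← Finset.sum_mul, hσ1, one_mul]
  rcases hs.1.eq_or_lt with rfl | hs0
  · simpa using hlog_a
  rcases hr.2.eq_or_lt with hr1 | hr1
  · have : r / ((d : ℝ) - 1) = 1 - r := by rw [hr1]; field_simp; ring
    rw [this]
    linarith
  set a : ℝ := 1 - r with ha
  set b : ℝ := r / ((d : ℝ) - 1) with hb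
  have hdb : ((d : ℝ) - 1) * b = r := mul_div_cancel₀ _ hd1.ne'
  have hb0 : 0 < b := div_pos hr0 hd1
  have hbd : b < 1 / d := by
    rw [hb, div_lt_div_iff₀ hd1 hd0]
    have := mul_lt_mul_of_pos_right hr1 hd0
    rw [sub_mul, div_mul_cancel₀ _ hd0.ne'] at this
    linarith
  have ha0 : 0 < a := hj0.trans_le hja
  have hent : ∑ i, ρ i * Real.log (ρ i) =
      a * Real.log a + ((d : ℝ) - 1) * (b * Real.log b) := by
    have := hrρ
    rw [qaryEntropy_eq_mul_log hd, shEntropy, Finset.sum_neg_distrib] at this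
    rw [← mul_assoc, hdb]
    linarith
  have hgibbs : ∀ β : ℝ, 0 < β → β * ∑ i, σ i * Real.log (ρ i) ≤
      Real.log (a ^ β + ((d : ℝ) - 1) * b ^ β) - shEntropy σ := by
    intro β hβ
    have hZ := sum_rpow_le j hρ0 hj hb0 (hbd.trans_le hjd) hja (by rw [hρ1, hdb]; ring) hent hβ
    set Z : ℝ := a ^ β + ((d : ℝ) - 1) * b ^ β
    have hZ0 : 0 < Z := by positivity
    have h := shEntropy_le_cross (τ := fun i => ρ i ^ β / Z) hσ0 hσ1
      (fun i => div_nonneg (Real.rpow_nonneg (hρ0 i) _) hZ0.le)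
      (by rw [← Finset.sum_div]; exact (div_le_one hZ0).2 hZ)
      (fun i hi => hac i <| by
        by_contra h
        have : 0 < ρ i := (hρ0 i).lt_of_ne' h
        exact absurd hi (by positivity))
    have heq : ∑ i, σ i * Real.log (ρ i ^ β / Z) =
        β * ∑ i, σ i * Real.log (ρ i) - Real.log Z := by
      have : ∀ i, σ i * Real.log (ρ i ^ β / Z) =
          β * (σ i * Real.log (ρ i)) - σ i * Real.log Z := by
        intro i
        rcases (hρ0 i).eq_or_lt with h | h
        · simp [hac i h.symm]
        · rw [Real.log_div (by positivity) hZ0.ne', Real.log_rpow h]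
          ring
      simp only [this]
      rw [Finset.sum_sub_distrib, ← Finset.mul_sum, ← Finset.sum_mul, hσ1, one_mul]
    rw [heq] at h
    linarith
  have hpq := qaryEntropy_eq_mul_log hd s
  rw [hsσ] at hpq
  rcases hs.2.eq_or_lt with hs1 | hs1
  · -- here `σ` is uniform; differentiate the Gibbs bound at `β = 0`
    have hσd : shEntropy σ = Real.log d := by
      rw [hpq, hs1, sub_sub_cancel, show (1 - 1 / (d : ℝ)) / (d - 1) = 1 / d by field_simp,
        one_div, Real.log_inv]
      ring
    have hder : HasDerivAt (fun β : ℝ => Real.log (a ^ β + ((d : ℝ) - 1) * b ^ β))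
        ((Real.log a + ((d : ℝ) - 1) * Real.log b) / d) 0 := by
      have h1 := (Real.hasStrictDerivAt_const_rpow ha0 0).hasDerivAt
      have h2 := (Real.hasStrictDerivAt_const_rpow hb0 0).hasDerivAt
      have h3 := (h1.add (h2.const_mul ((d : ℝ) - 1))).log (by simp [hd0.ne'])
      convert! h3 using 1
      simp
    have hlim := hder.tendsto_slope_zero_right
    have hle : ∑ i, σ i * Real.log (ρ i) ≤ (Real.log a + ((d : ℝ) - 1) * Real.log b) / d := by
      refine ge_of_tendsto hlim ?_
      filter_upwards [self_mem_nhdsWithin] with β hβ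
      have hβ : 0 < β := hβ
      have := hgibbs β hβ
      simp only [zero_add, Real.rpow_zero, mul_one, add_sub_cancel, smul_eq_mul]
      rw [← div_eq_inv_mul, le_div_iff₀ hβ]
      linarith
    convert! hle using 1
    rw [hs1]
    field_simp
    ring
  · have hp : 0 < 1 - s := by
      have : 0 < 1 / (d : ℝ) := by positivity
      linarith
    have hq : 0 < s / ((d : ℝ) - 1) := div_pos hs0 hd1
    have hqp : s / ((d : ℝ) - 1) < 1 - s := by
      rw [div_lt_iff₀ hd1]
      have := mul_lt_mul_of_pos_right hs1 hd0
      rw [sub_mul, div_mul_cancel₀ _ hd0.ne'] at this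
      linarith
    have hlogab : 0 < Real.log a - Real.log b :=
      sub_pos.2 (Real.log_lt_log hb0 ((hbd.trans_le hjd).trans_le hja))
    obtain ⟨β, hβ⟩ : ∃ β : ℝ, β * (Real.log a - Real.log b) =
        Real.log (1 - s) - Real.log (s / ((d : ℝ) - 1)) := ⟨_, div_mul_cancel₀ _ hlogab.ne'⟩
    have hβ0 : 0 < β := by
      refine pos_of_mul_pos_left ?_ hlogab.le
      rw [hβ]
      exact sub_pos.2 (Real.log_lt_log hq hqp)
    have hratio : a ^ β * (s / ((d : ℝ) - 1)) = b ^ β * (1 - s) := by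
      refine Real.log_injOn_pos (Set.mem_Ioi.2 (by positivity)) (Set.mem_Ioi.2 (by positivity)) ?_
      rw [Real.log_mul (by positivity) hq.ne', Real.log_mul (by positivity) hp.ne',
        Real.log_rpow ha0, Real.log_rpow hb0]
      linarith
    have hZ : a ^ β + ((d : ℝ) - 1) * b ^ β = b ^ β / (s / ((d : ℝ) - 1)) := by
      rw [eq_div_iff hq.ne', add_mul, hratio]
      field_simp
      ring
    have h := hgibbs β hβ0
    rw [hZ, Real.log_div (by positivity) hq.ne', Real.log_rpow hb0, hpq] at h
    refine le_of_mul_le_mul_left (h.trans_eq ?_) hβ0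
    linear_combination (s - 1) * hβ

/-- A vector dominated by a vector of zero entropy has zero entropy. -/
lemma shEntropy_eq_zero_of_dominated {d : ℕ} {σ ρ : Fin d → ℝ} (hσ1 : ∑ i, σ i = 1)
    (hρ0 : ∀ i, 0 ≤ ρ i) (hρ1 : ∑ i, ρ i = 1) (hac : ∀ i, ρ i = 0 → σ i = 0)
    (h : shEntropy ρ = 0) : shEntropy σ = 0 := by
  have hle : ∀ i, ρ i ≤ 1 := fun i =>
    hρ1 ▸ Finset.single_le_sum (fun i _ => hρ0 i) (Finset.mem_univ i)
  obtain ⟨j, -, hj⟩ := Finset.exists_ne_zero_of_sum_ne_zero (hρ1.trans_ne one_ne_zero)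
  have hjlog := (Finset.sum_eq_zero_iff_of_nonneg fun i _ =>
    neg_nonneg.2 (Real.mul_log_nonpos (hρ0 i) (hle i))).1 h j (Finset.mem_univ j)
  have hj1 : ρ j = 1 := by
    have h0 : Real.log (ρ j) = 0 := by simpa [hj] using hjlog
    exact Real.eq_one_of_pos_of_log_eq_zero ((hρ0 j).lt_of_ne' hj) h0
  have hσ : ∀ i, i ≠ j → σ i = 0 := fun i hi => hac i <| by
    have h1 := Finset.add_sum_erase Finset.univ ρ (Finset.mem_univ j)
    have h2 := Finset.single_le_sum (f := ρ) (fun i _ => hρ0 i)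
      (Finset.mem_erase.2 ⟨hi, Finset.mem_univ i⟩)
    linarith [hρ0 i]
  have hσj : σ j = 1 := by
    rwa [Finset.sum_eq_single j (fun i _ hi => hσ i hi) (by simp)] at hσ1
  refine Finset.sum_eq_zero fun i _ => ?_
  rcases eq_or_ne i j with rfl | hi
  · simp [hσj]
  · simp [hσ i hi]

/-- tight lower bound on relative entropy by entropy difference. -/
theorem relEntropy_ge_Mfun (d : ℕ) (hd : 2 ≤ d) (σ ρ : Fin d → ℝ)
    (hσ0 : ∀ i, 0 ≤ σ i) (hσ1 : ∑ i, σ i = 1)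
    (hρ0 : ∀ i, 0 ≤ ρ i) (hρ1 : ∑ i, ρ i = 1) :
    Mfun (shEntropy σ - shEntropy ρ) d ≤ relEntropy σ ρ := by
  have hd' : (2 : ℝ) ≤ d := by exact_mod_cast hd
  have hd1 : (0 : ℝ) < d - 1 := by linarith
  have hd0 : (0 : ℝ) < d := by linarith
  rw [relEntropy]
  split_ifs with hac
  swap
  · exact le_top
  obtain ⟨s, hs, hsσ⟩ := exists_qaryEntropy_eq hd (shEntropy_nonneg hσ0 hσ1)
    (shEntropy_le_log hd hσ0 hσ1)
  obtain ⟨r, hr, hrρ⟩ := exists_qaryEntropy_eq hd (shEntropy_nonneg hρ0 hρ1)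
    (shEntropy_le_log hd hρ0 hρ1)
  have hIcc : ((d : ℝ) - 1) / d = 1 - 1 / d := by field_simp
  have hdinv : 0 < 1 / (d : ℝ) := by positivity
  have hr1 : r < 1 := by linarith [hr.2]
  have hs1 : s < 1 := by linarith [hs.2]
  have hmem : Mfun (shEntropy σ - shEntropy ρ) d ≤ binRelEntropy s r := by
    refine sInf_le ⟨s, r, hs, hr, ?_, rfl⟩
    rw [← hsσ, ← hrρ, qaryEntropy_eq, qaryEntropy_eq]
    ring
  refine hmem.trans ?_
  rcases hr.1.eq_or_lt with rfl | hr0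
  · have hs0 : s = 0 := by
      have h0 : shEntropy ρ = 0 := by rw [← hrρ, Real.qaryEntropy_zero]
      rw [shEntropy_eq_zero_of_dominated hσ1 hρ0 hρ1 hac h0] at hsσ
      rw [hIcc] at hs hr
      exact (Real.qaryEntropy_strictMonoOn hd).injOn hs hr
        (hsσ.trans (Real.qaryEntropy_zero d).symm)
    simp [hs0, binRelEntropy]
  rw [binRelEntropy, if_neg (by rintro (⟨h, -⟩ | ⟨h, -⟩) <;> linarith)]
  refine ENNReal.ofReal_le_ofReal ?_
  have hcross := sum_mul_log_le hd hσ0 hσ1 hρ0 hρ1 hac hs hr hr0 hsσ hrρ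
  have hD : ∑ i, σ i * Real.log (σ i / ρ i) =
      -shEntropy σ - ∑ i, σ i * Real.log (ρ i) := by
    rw [shEntropy, Finset.sum_neg_distrib, neg_neg, ← Finset.sum_sub_distrib]
    refine Finset.sum_congr rfl fun i _ => ?_
    rcases eq_or_ne (σ i) 0 with h | h
    · simp [h]
    · rw [Real.log_div h fun h0 => h (hac i h0), mul_sub]
  have hD₂ : s * Real.log (s / r) = s * Real.log s - s * Real.log r := by
    rcases eq_or_ne s 0 with h | h
    · simp [h]
    · rw [Real.log_div h hr0.ne', mul_sub]
  rw [hD, ← hsσ, qaryEntropy_eq, binEntropy', hD₂, Real.log_div (by linarith) (by linarith)]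
  rw [Real.log_div hr0.ne' hd1.ne'] at hcross
  linarith

end
end

section
/- Let d ≥ 2 be an integer. The function Δ ↦ M(Δ,d), which is finite on [-log d, log d), is continuous and strictly convex on the interval [-log d, log d) (as a real-valued function), and M(Δ,d) → ∞ as Δ → log d. -/
open scoped ENNReal BigOperators

noncomputable section

namespace EntropyGap

open Real Set Filter Topology

/-- A continuous strictly increasing function on a compact interval has a continuous inverse. -/
lemma exists_continuousOn_rightInverse {f : ℝ → ℝ} {x y : ℝ} (hxy : x ≤ y)
    (hc : ContinuousOn f (Icc x y)) (hm : StrictMonoOn f (Icc x y)) :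
    ∃ g : ℝ → ℝ, ContinuousOn g (Icc (f x) (f y)) ∧
      ∀ v ∈ Icc (f x) (f y), g v ∈ Icc x y ∧ f (g v) = v := by
  have himg : f '' Icc x y = Icc (f x) (f y) := hc.image_Icc_of_monotoneOn hxy hm.monotoneOn
  let e : Icc x y ≃o Icc (f x) (f y) :=
    (hm.orderIso f (Icc x y)).trans (OrderIso.setCongr _ _ himg)
  have he : ∀ z, (e z : ℝ) = f z := fun z => rfl
  have hlt : f x ≤ f y := hm.monotoneOn (left_mem_Icc.2 hxy) (right_mem_Icc.2 hxy) hxy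
  refine ⟨IccExtend hlt (fun v => (e.symm v : ℝ)), ?_, fun v hv => ?_⟩
  · exact ((continuous_subtype_val.comp e.symm.continuous).Icc_extend').continuousOn
  · rw [IccExtend_of_mem hlt _ hv]
    exact ⟨(e.symm ⟨v, hv⟩).2, by rw [← he, e.apply_symm_apply]⟩

/-- A function starting at zero with negative slope whose second derivative changes sign at most
once, from negative to positive, is negative before its positive zero and positive after it. -/
lemma sign_of_secondDeriv_sign {P P' w R : ℝ → ℝ} (hP : ∀ x, HasDerivAt P (P' x) x)
    (hP' : ∀ x, HasDerivAt P' (w x * R x) x) (hw : ∀ x, 0 < w x)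
    (hR : StrictMonoOn R (Ici 0)) (h0 : P 0 = 0) (h0' : P' 0 < 0)
    {z : ℝ} (hz : 0 < z) (hPz : P z = 0) :
    (∀ x, 0 < x → x < z → P x < 0) ∧ ∀ x, z < x → 0 < P x := by
  have hcP : Continuous P := continuous_iff_continuousAt.2 fun x => (hP x).continuousAt
  have hcP' : Continuous P' := continuous_iff_continuousAt.2 fun x => (hP' x).continuousAt
  have key : ∀ x, 0 < x → 0 ≤ P' x → ∀ y, x < y → P' x < P' y := by
    intro x hx hPx y hxy
    obtain ⟨η, hη, hd⟩ := exists_hasDerivAt_eq_slope P' (fun t => w t * R t) hx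
      hcP'.continuousOn (fun t _ => hP' t)
    have hpos : 0 < w η * R η := by
      rw [hd]; exact div_pos (by linarith) (by linarith)
    have hRη : 0 < R η := (mul_pos_iff_of_pos_left (hw η)).1 hpos
    refine strictMonoOn_of_deriv_pos (convex_Ici x) hcP'.continuousOn (fun t ht => ?_)
      self_mem_Ici hxy.le hxy
    rw [interior_Ici] at ht
    rw [(hP' t).deriv]
    have hηt : η < t := hη.2.trans ht
    exact mul_pos (hw t) (hRη.trans (hR hη.1.le (hη.1.trans hηt).le hηt))
  obtain ⟨ξ, hξ, hdξ⟩ := exists_hasDerivAt_eq_zero hz hcP.continuousOn (h0.trans hPz.symm)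
    (fun t _ => hP t)
  have hneg : ∀ x, 0 < x → x < ξ → P' x < 0 := fun x hx hxξ => by
    by_contra hge
    have := key x hx (not_lt.1 hge) ξ hxξ
    linarith [not_lt.1 hge]
  have hpos : ∀ x, ξ < x → 0 < P' x := fun x hx => hdξ ▸ key ξ hξ.1 hdξ.ge x hx
  have hanti : StrictAntiOn P (Icc 0 ξ) :=
    strictAntiOn_of_deriv_neg (convex_Icc 0 ξ) hcP.continuousOn fun t ht => by
      rw [interior_Icc] at ht
      rw [(hP t).deriv]
      exact hneg t ht.1 ht.2
  have hmono : StrictMonoOn P (Ici ξ) :=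
    strictMonoOn_of_deriv_pos (convex_Ici ξ) hcP.continuousOn fun t ht => by
      rw [interior_Ici] at ht
      rw [(hP t).deriv]
      exact hpos t ht
  refine ⟨fun x hx hxz => ?_, fun x hx => ?_⟩
  · rcases le_total x ξ with hxξ | hxξ
    · exact h0 ▸ hanti ⟨le_rfl, hξ.1.le⟩ ⟨hx.le, hxξ⟩ hx
    · exact hPz ▸ hmono hxξ hξ.2.le hxz
  · exact hPz ▸ hmono hξ.2.le (hξ.2.le.trans hx.le) hx

/-- A continuous function on `[0, ∞)` with derivative negative before `z` and positive after `z`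
has its strict global minimum at `z`. -/
lemma lt_of_deriv_sign {K K' : ℝ → ℝ} (hK : ∀ x, HasDerivAt K (K' x) x) {z : ℝ} (hz : 0 < z)
    (hneg : ∀ x, 0 < x → x < z → K' x < 0) (hpos : ∀ x, z < x → 0 < K' x)
    {x : ℝ} (hx : 0 ≤ x) (hxz : x ≠ z) : K z < K x := by
  have hcK : Continuous K := continuous_iff_continuousAt.2 fun x => (hK x).continuousAt
  rcases lt_or_gt_of_ne hxz with h | h
  · refine strictAntiOn_of_deriv_neg (convex_Icc 0 z) hcK.continuousOn (fun t ht => ?_)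
      ⟨hx, h.le⟩ ⟨hz.le, le_rfl⟩ h
    rw [interior_Icc] at ht
    rw [(hK t).deriv]
    exact hneg t ht.1 ht.2
  · refine strictMonoOn_of_deriv_pos (convex_Ici z) hcK.continuousOn (fun t ht => ?_)
      self_mem_Ici h.le h
    rw [interior_Ici] at ht
    rw [(hK t).deriv]
    exact hpos t ht

/-- Sign pattern of the derivative of the Lagrangian along Gibbs states, up to a positive factor. -/
lemma sign_criticalFun {a μ : ℝ} (ha : 0 < a) (hμ : 0 < μ) (hμ1 : μ ≠ 1) {z : ℝ} (hz : 0 < z)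
    (hPz : (exp z - exp (μ * z)) * (a + exp z) / exp z
      - (1 / μ - 1) * z * (a + exp (μ * z)) = 0) :
    (∀ x, 0 < x → x < z → (exp x - exp (μ * x)) * (a + exp x) / exp x
      - (1 / μ - 1) * x * (a + exp (μ * x)) < 0) ∧
    ∀ x, z < x → 0 < (exp x - exp (μ * x)) * (a + exp x) / exp x
      - (1 / μ - 1) * x * (a + exp (μ * x)) := by
  have hrw : ∀ x, (exp x - exp (μ * x)) * (a + exp x) / exp x
      - (1 / μ - 1) * x * (a + exp (μ * x)) =
      exp x - exp (μ * x) * (1 + (1 / μ - 1) * x) + a * (1 - (1 / μ - 1) * x)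
        - a * exp ((μ - 1) * x) := by
    intro x
    have : exp (μ * x) = exp ((μ - 1) * x) * exp x := by rw [← exp_add]; ring_nf
    have hx := (exp_pos x).ne'
    rw [this]
    field_simp
    ring
  simp only [hrw] at hPz ⊢
  have hlin : ∀ c x : ℝ, HasDerivAt (fun x => exp (c * x)) (exp (c * x) * c) x := fun c x => by
    simpa using ((hasDerivAt_id x).const_mul c).exp
  have haff : ∀ p c x : ℝ, HasDerivAt (fun x => p + c * x) c x := fun p c x => by
    simpa using ((hasDerivAt_id x).const_mul c).const_add p
  refine sign_of_secondDeriv_sign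
    (P' := fun x => exp x - exp (μ * x) * (μ + (1 / μ - 1) + (1 - μ) * x) - a * (1 / μ - 1)
      - a * (μ - 1) * exp ((μ - 1) * x))
    (w := fun x => exp (μ * x))
    (R := fun x => exp ((1 - μ) * x) - (μ ^ 2 + 2 * (1 - μ) + μ * (1 - μ) * x)
      - a * (μ - 1) ^ 2 * exp (-1 * x)) ?_ ?_ (fun x => exp_pos _) ?_ ?_ ?_ hz hPz
  · intro x
    have := (((hasDerivAt_exp x).sub ((hlin μ x).mul (haff 1 (1 / μ - 1) x))).add
      ((haff 1 (-(1 / μ - 1)) x).const_mul a)).sub ((hlin (μ - 1) x).const_mul a)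
    refine (this.congr_deriv ?_).congr_of_eventuallyEq (Eventually.of_forall fun y => ?_)
    · field_simp
      ring
    · simp only [Pi.add_apply, Pi.sub_apply, Pi.mul_apply]
      ring
  · intro x
    have := (((hasDerivAt_exp x).sub ((hlin μ x).mul
      (haff (μ + (1 / μ - 1)) (1 - μ) x))).sub_const (a * (1 / μ - 1))).sub
      ((hlin (μ - 1) x).const_mul (a * (μ - 1)))
    refine (this.congr_deriv ?_).congr_of_eventuallyEq (Eventually.of_forall fun y => ?_)
    · have h1 : exp x = exp (μ * x) * exp ((1 - μ) * x) := by rw [← exp_add]; ring_nf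
      have h2 : exp ((μ - 1) * x) = exp (μ * x) * exp (-1 * x) := by rw [← exp_add]; ring_nf
      rw [h1, h2]
      field_simp
      ring
    · simp only [Pi.sub_apply, Pi.mul_apply]
  · have hder : ∀ x, HasDerivAt (fun x => exp ((1 - μ) * x)
        - (μ ^ 2 + 2 * (1 - μ) + μ * (1 - μ) * x) - a * (μ - 1) ^ 2 * exp (-1 * x))
        ((1 - μ) * (exp ((1 - μ) * x) - μ) + a * (μ - 1) ^ 2 * exp (-1 * x)) x := fun x =>
      (((hlin (1 - μ) x).sub (haff (μ ^ 2 + 2 * (1 - μ)) (μ * (1 - μ)) x)).sub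
        ((hlin (-1) x).const_mul (a * (μ - 1) ^ 2))).congr_deriv (by ring)
    refine strictMonoOn_of_deriv_pos (convex_Ici 0)
      (fun x _ => (hder x).continuousAt.continuousWithinAt) fun x hx => ?_
    rw [interior_Ici] at hx
    rw [(hder x).deriv]
    have hx' : 0 < x := hx
    have hpos : 0 < a * (μ - 1) ^ 2 * exp (-1 * x) :=
      mul_pos (mul_pos ha (sq_pos_of_ne_zero (sub_ne_zero.2 hμ1))) (exp_pos _)
    refine add_pos_of_nonneg_of_pos ?_ hpos
    rcases lt_or_gt_of_ne hμ1 with h | h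
    · have : 1 ≤ exp ((1 - μ) * x) := one_le_exp (mul_nonneg (by linarith) hx'.le)
      exact mul_nonneg (by linarith) (by linarith)
    · have : exp ((1 - μ) * x) ≤ 1 := exp_le_one_iff.2
        (mul_nonpos_of_nonpos_of_nonneg (by linarith) hx'.le)
      exact mul_nonneg_of_nonpos_of_nonpos (by linarith) (by linarith)
  · simp
  · simp only [mul_zero, exp_zero, add_zero, mul_one, one_mul]
    have : 1 - (μ + (1 / μ - 1)) - a * (1 / μ - 1) - a * (μ - 1)
        = -((1 + a) * (μ - 1) ^ 2 / μ) := by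
      field_simp
      ring
    rw [this, neg_lt_zero]
    exact div_pos (mul_pos (by linarith) (sq_pos_of_ne_zero (sub_ne_zero.2 hμ1))) hμ

/-- Entropy of the probability vector with weight `1 - x` on one point and the weight `x` spread
evenly over `a` further points. -/
def ent (a x : ℝ) : ℝ := binEntropy' x + x * log a

/-- The derivative of `ent a`, an inverse temperature. -/
def invTemp (a x : ℝ) : ℝ := log ((1 - x) * a / x)

/-- The inverse function of `invTemp a`. -/
def gibbs (a b : ℝ) : ℝ := a / (a + exp b)

/-- The Bregman divergence of `-ent a`, which is the binary relative entropy. -/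
def bregman (a s r : ℝ) : ℝ := ent a r - ent a s + (s - r) * invTemp a r

variable {a : ℝ}

lemma invTemp_eq (ha : 0 < a) {x : ℝ} (hx0 : 0 < x) (hx1 : x < 1) :
    invTemp a x = log (1 - x) + log a - log x := by
  have h1 : 0 < 1 - x := by linarith
  rw [invTemp, log_div (by positivity) hx0.ne', log_mul h1.ne' ha.ne']

lemma gibbs_pos (ha : 0 < a) (b : ℝ) : 0 < gibbs a b := by
  unfold gibbs; positivity

lemma one_sub_gibbs (ha : 0 < a) (b : ℝ) : 1 - gibbs a b = exp b / (a + exp b) := by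
  have : a + exp b ≠ 0 := by positivity
  unfold gibbs
  field_simp
  ring

lemma gibbs_lt_one (ha : 0 < a) (b : ℝ) : gibbs a b < 1 := by
  have : 0 < 1 - gibbs a b := by rw [one_sub_gibbs ha]; positivity
  linarith

lemma gibbs_zero : gibbs a 0 = a / (1 + a) := by
  rw [gibbs, exp_zero, add_comm]

lemma gibbs_strictAnti (ha : 0 < a) : StrictAnti (gibbs a) := fun x y hxy => by
  unfold gibbs
  gcongr

lemma invTemp_gibbs (ha : 0 < a) (b : ℝ) : invTemp a (gibbs a b) = b := by
  have h1 := (exp_pos b).ne'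
  have : a + exp b ≠ 0 := by positivity
  rw [invTemp, one_sub_gibbs ha, gibbs,
    show exp b / (a + exp b) * a / (a / (a + exp b)) = exp b by field_simp, log_exp]

lemma gibbs_invTemp (ha : 0 < a) {x : ℝ} (hx0 : 0 < x) (hx1 : x < 1) :
    gibbs a (invTemp a x) = x := by
  have h1 : 0 < 1 - x := by linarith
  rw [gibbs, invTemp, exp_log (by positivity)]
  field_simp
  ring

lemma maxWeight_pos (ha : 0 < a) : 0 < a / (1 + a) := by positivity

lemma maxWeight_lt_one (ha : 0 < a) : a / (1 + a) < 1 := by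
  rw [div_lt_one (by linarith)]; linarith

lemma invTemp_maxWeight (ha : 0 < a) : invTemp a (a / (1 + a)) = 0 := by
  rw [← gibbs_zero, invTemp_gibbs ha]

lemma invTemp_lt_invTemp (ha : 0 < a) {x y : ℝ} (hx : 0 < x) (hxy : x < y) (hy : y < 1) :
    invTemp a y < invTemp a x := by
  rw [← (gibbs_strictAnti ha).lt_iff_gt, gibbs_invTemp ha hx (hxy.trans hy),
    gibbs_invTemp ha (hx.trans hxy) hy]
  exact hxy

lemma invTemp_le_invTemp (ha : 0 < a) {x y : ℝ} (hx : 0 < x) (hxy : x ≤ y) (hy : y < 1) :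
    invTemp a y ≤ invTemp a x := by
  rcases hxy.eq_or_lt with rfl | h
  · exact le_rfl
  · exact (invTemp_lt_invTemp ha hx h hy).le

lemma invTemp_pos (ha : 0 < a) {x : ℝ} (hx : 0 < x) (hxR : x < a / (1 + a)) :
    0 < invTemp a x :=
  invTemp_maxWeight ha ▸ invTemp_lt_invTemp ha hx hxR (maxWeight_lt_one ha)

lemma invTemp_nonneg (ha : 0 < a) {x : ℝ} (hx : x ∈ Ioc 0 (a / (1 + a))) : 0 ≤ invTemp a x := by
  rcases hx.2.lt_or_eq with h | h
  · exact (invTemp_pos ha hx.1 h).le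
  · rw [h, invTemp_maxWeight ha]

lemma continuousOn_invTemp (ha : 0 < a) : ContinuousOn (invTemp a) (Ioo 0 1) := by
  intro x hx
  have h0 : 0 < x := hx.1
  have h1 : 0 < 1 - x := by linarith [hx.2]
  unfold invTemp
  exact (ContinuousAt.log (by fun_prop (disch := exact h0.ne'))
    (by positivity)).continuousWithinAt

lemma tendsto_invTemp_zero (ha : 0 < a) : Tendsto (invTemp a) (𝓝[>] 0) atTop := by
  refine tendsto_log_atTop.comp ?_
  have h1 : Tendsto (fun x : ℝ => (1 - x) * a) (𝓝[>] 0) (𝓝 a) := by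
    have : Tendsto (fun x : ℝ => (1 - x) * a) (𝓝 0) (𝓝 ((1 - 0) * a)) :=
      Continuous.tendsto (by fun_prop) 0
    simpa using this.mono_left nhdsWithin_le_nhds
  exact h1.pos_mul_atTop ha tendsto_inv_nhdsGT_zero

lemma ent_eq (a x : ℝ) : ent a x = -(x * log x) - (1 - x) * log (1 - x) + x * log a := rfl

lemma continuous_ent : Continuous (ent a) := by
  have h : Continuous fun x : ℝ => (1 - x) * log (1 - x) :=
    continuous_mul_log.comp (by fun_prop)
  exact ((continuous_mul_log.neg).sub h).add (by fun_prop)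

lemma hasDerivAt_ent (ha : 0 < a) {x : ℝ} (hx0 : 0 < x) (hx1 : x < 1) :
    HasDerivAt (ent a) (invTemp a x) x := by
  have h1 : 0 < 1 - x := by linarith
  have hd := (((hasDerivAt_mul_log hx0.ne').neg).sub
    ((hasDerivAt_mul_log h1.ne').comp x ((hasDerivAt_id x).const_sub 1))).add
    ((hasDerivAt_id x).mul_const (log a))
  refine (hd.congr_deriv ?_).congr_of_eventuallyEq (Eventually.of_forall fun y => ?_)
  · rw [invTemp_eq ha hx0 hx1]; ring
  · simp [ent_eq]

lemma strictMonoOn_ent (ha : 0 < a) : StrictMonoOn (ent a) (Icc 0 (a / (1 + a))) :=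
  strictMonoOn_of_deriv_pos (convex_Icc _ _) continuous_ent.continuousOn fun x hx => by
    rw [interior_Icc] at hx
    rw [(hasDerivAt_ent ha hx.1 (hx.2.trans (maxWeight_lt_one ha))).deriv]
    exact invTemp_pos ha hx.1 hx.2

lemma ent_zero : ent a 0 = 0 := by simp [ent_eq]

lemma ent_maxWeight (ha : 0 < a) : ent a (a / (1 + a)) = log (1 + a) := by
  have h : 1 - a / (1 + a) = 1 / (1 + a) := by field_simp; ring
  rw [ent_eq, h, log_div ha.ne' (by positivity), log_div one_ne_zero (by positivity), log_one]
  field_simp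
  ring

lemma ent_mem (ha : 0 < a) {x : ℝ} (hx : x ∈ Icc 0 (a / (1 + a))) :
    ent a x ∈ Icc 0 (log (1 + a)) := by
  have hR := (maxWeight_pos ha).le
  have hm := (strictMonoOn_ent ha).monotoneOn
  exact ⟨ent_zero (a := a) ▸ hm ⟨le_rfl, hR⟩ hx hx.1,
    ent_maxWeight ha ▸ hm hx ⟨hR, le_rfl⟩ hx.2⟩

lemma le_of_ent_le (ha : 0 < a) {x y : ℝ} (hx : x ∈ Icc 0 (a / (1 + a)))
    (hy : y ∈ Icc 0 (a / (1 + a))) (h : ent a x ≤ ent a y) : x ≤ y :=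
  ((strictMonoOn_ent ha).le_iff_le hx hy).1 h

lemma lt_of_ent_lt (ha : 0 < a) {x y : ℝ} (hx : x ∈ Icc 0 (a / (1 + a)))
    (hy : y ∈ Icc 0 (a / (1 + a))) (h : ent a x < ent a y) : x < y :=
  ((strictMonoOn_ent ha).lt_iff_lt hx hy).1 h

/-- A continuous inverse of `ent a` on the weights up to the maximiser of the entropy. -/
lemma exists_inverse_ent (ha : 0 < a) :
    ∃ g : ℝ → ℝ, ContinuousOn g (Icc 0 (log (1 + a))) ∧
      (∀ v ∈ Icc 0 (log (1 + a)), g v ∈ Icc 0 (a / (1 + a)) ∧ ent a (g v) = v) ∧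
      (∀ v ∈ Ioc 0 (log (1 + a)), 0 < g v) ∧ (∀ v ∈ Ico 0 (log (1 + a)), g v < a / (1 + a)) ∧
      g 0 = 0 ∧ g (log (1 + a)) = a / (1 + a) := by
  have hR0 := (maxWeight_pos ha).le
  have hlog : 0 ≤ log (1 + a) := log_nonneg (by linarith)
  have h := exists_continuousOn_rightInverse hR0 continuous_ent.continuousOn (strictMonoOn_ent ha)
  rw [ent_zero, ent_maxWeight ha] at h
  obtain ⟨g, hgc, hg⟩ := h
  refine ⟨g, hgc, hg, fun v hv => ?_, fun v hv => ?_, ?_, ?_⟩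
  · have h := hg v ⟨hv.1.le, hv.2⟩
    exact lt_of_ent_lt ha ⟨le_rfl, hR0⟩ h.1 (by rw [ent_zero, h.2]; exact hv.1)
  · have h := hg v ⟨hv.1, hv.2.le⟩
    exact lt_of_ent_lt ha h.1 ⟨hR0, le_rfl⟩ (by rw [ent_maxWeight ha, h.2]; exact hv.2)
  · have h := hg 0 ⟨le_rfl, hlog⟩
    exact le_antisymm (le_of_ent_le ha h.1 ⟨le_rfl, hR0⟩ (by rw [h.2, ent_zero])) h.1.1
  · have h := hg (log (1 + a)) ⟨hlog, le_rfl⟩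
    exact le_antisymm h.1.2 (le_of_ent_le ha ⟨hR0, le_rfl⟩ h.1 (by rw [h.2, ent_maxWeight ha]))

lemma sub_le_mul_log_sub {s r : ℝ} (hs : 0 ≤ s) (hr : 0 < r) :
    s - r ≤ s * (log s - log r) ∧ (s ≠ r → s - r < s * (log s - log r)) := by
  rcases hs.eq_or_lt with rfl | hs
  · simp [hr, hr.le]
  · have key : s * (r / s - 1) = r - s := by field_simp
    have hl : log (r / s) = log r - log s := log_div hr.ne' hs.ne'
    constructor
    · have := mul_le_mul_of_nonneg_left (log_le_sub_one_of_pos (div_pos hr hs)) hs.le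
      rw [key, hl] at this
      linarith
    · intro hne
      have h1 : r / s ≠ 1 := fun h => hne ((div_eq_one_iff_eq hs.ne').1 h).symm
      have := mul_lt_mul_of_pos_left (log_lt_sub_one_of_pos (div_pos hr hs) h1) hs
      rw [key, hl] at this
      linarith

lemma bregman_eq (ha : 0 < a) {s r : ℝ} (hr0 : 0 < r) (hr1 : r < 1) :
    bregman a s r = s * (log s - log r) + (1 - s) * (log (1 - s) - log (1 - r)) := by
  rw [bregman, invTemp_eq ha hr0 hr1, ent_eq, ent_eq]
  ring

lemma bregman_nonneg (ha : 0 < a) {s r : ℝ} (hs : 0 ≤ s) (hs1 : s ≤ 1) (hr0 : 0 < r)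
    (hr1 : r < 1) : 0 ≤ bregman a s r := by
  rw [bregman_eq ha hr0 hr1]
  linarith [(sub_le_mul_log_sub hs hr0).1,
    (sub_le_mul_log_sub (sub_nonneg.2 hs1) (sub_pos.2 hr1)).1]

lemma bregman_pos (ha : 0 < a) {s r : ℝ} (hs : 0 ≤ s) (hs1 : s ≤ 1) (hr0 : 0 < r)
    (hr1 : r < 1) (hsr : s ≠ r) : 0 < bregman a s r := by
  rw [bregman_eq ha hr0 hr1]
  linarith [(sub_le_mul_log_sub hs hr0).2 hsr,
    (sub_le_mul_log_sub (sub_nonneg.2 hs1) (sub_pos.2 hr1)).1]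

lemma bregman_self (r : ℝ) : bregman a r r = 0 := by
  simp [bregman]

lemma binRelEntropy_eq (ha : 0 < a) {s r : ℝ} (hs : 0 ≤ s) (hs1 : s < 1) (hr0 : 0 < r)
    (hr1 : r < 1) : binRelEntropy s r = ENNReal.ofReal (bregman a s r) := by
  have h : s * log (s / r) = s * (log s - log r) := by
    rcases hs.eq_or_lt with rfl | hs
    · simp
    · rw [log_div hs.ne' hr0.ne']
  rw [binRelEntropy, if_neg (by rintro (h | h) <;> linarith [h.1]), bregman_eq ha hr0 hr1, h,
    log_div (by linarith) (by linarith)]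

lemma hasDerivAt_gibbs (ha : 0 < a) (b : ℝ) :
    HasDerivAt (gibbs a) (-(gibbs a b * (1 - gibbs a b))) b := by
  have hne : a + exp b ≠ 0 := by positivity
  refine ((hasDerivAt_const b a).div ((hasDerivAt_exp b).const_add a) hne).congr_deriv ?_
  rw [one_sub_gibbs ha, gibbs]
  field_simp
  ring

lemma hasDerivAt_ent_gibbs (ha : 0 < a) (b : ℝ) :
    HasDerivAt (fun b => ent a (gibbs a b)) (b * -(gibbs a b * (1 - gibbs a b))) b := by
  have := (hasDerivAt_ent ha (gibbs_pos ha b) (gibbs_lt_one ha b)).comp b (hasDerivAt_gibbs ha b)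
  rwa [invTemp_gibbs ha] at this

/-- An interior critical point of the relative entropy at fixed entropy difference is the unique
global minimiser of the corresponding Lagrangian. -/
lemma support_of_critical (ha : 0 < a) {s₀ r₀ : ℝ} (hs₀ : s₀ ∈ Ioo 0 (a / (1 + a)))
    (hr₀ : r₀ ∈ Ioo 0 (a / (1 + a))) (hne : s₀ ≠ r₀)
    (hcrit : (s₀ - r₀) * invTemp a s₀ =
      r₀ * (1 - r₀) * invTemp a r₀ * (invTemp a r₀ - invTemp a s₀)) :
    ∃ l : ℝ, ∀ s ∈ Icc 0 (a / (1 + a)), ∀ r ∈ Ioc 0 (a / (1 + a)), (s, r) ≠ (s₀, r₀) →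
      bregman a s₀ r₀ + l * (ent a s - ent a r - (ent a s₀ - ent a r₀)) < bregman a s r := by
  have hR1 := maxWeight_lt_one ha
  have hs₀1 : s₀ < 1 := hs₀.2.trans hR1
  have hr₀1 : r₀ < 1 := hr₀.2.trans hR1
  have hbs : 0 < invTemp a s₀ := invTemp_pos ha hs₀.1 hs₀.2
  have hbr : 0 < invTemp a r₀ := invTemp_pos ha hr₀.1 hr₀.2
  have hgs : gibbs a (invTemp a s₀) = s₀ := gibbs_invTemp ha hs₀.1 hs₀1
  have hgr : gibbs a (invTemp a r₀) = r₀ := gibbs_invTemp ha hr₀.1 hr₀1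
  set z := invTemp a r₀ with hz
  obtain ⟨μ, hμ⟩ : ∃ μ, μ = invTemp a s₀ / z := ⟨_, rfl⟩
  have hμ0 : 0 < μ := hμ ▸ div_pos hbs hbr
  have hμz : invTemp a s₀ = μ * z := by rw [hμ]; field_simp
  have hμ1 : μ ≠ 1 := by
    rintro rfl
    rw [one_mul] at hμz
    exact hne (by rw [← hgs, hμz, hgr])
  rw [hμz] at hcrit hgs
  have hfactor : ∀ b, gibbs a (μ * b) - gibbs a b
        - (1 / μ - 1) * b * (gibbs a b * (1 - gibbs a b)) =
      gibbs a b * (1 - gibbs a b) / (a + exp (μ * b)) *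
        ((exp b - exp (μ * b)) * (a + exp b) / exp b
          - (1 / μ - 1) * b * (a + exp (μ * b))) := by
    intro b
    have h1 : a + exp b ≠ 0 := by positivity
    have h2 : a + exp (μ * b) ≠ 0 := by positivity
    have h3 := (exp_pos b).ne'
    rw [one_sub_gibbs ha, gibbs, gibbs]
    field_simp
    ring
  have hfpos : ∀ b, 0 < gibbs a b * (1 - gibbs a b) / (a + exp (μ * b)) := fun b =>
    div_pos (mul_pos (gibbs_pos ha b) (sub_pos.2 (gibbs_lt_one ha b))) (by positivity)
  have hzero : (exp z - exp (μ * z)) * (a + exp z) / exp z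
      - (1 / μ - 1) * z * (a + exp (μ * z)) = 0 := by
    have h := hfactor z
    rw [hgs, hgr] at h
    have h0 : s₀ - r₀ - (1 / μ - 1) * z * (r₀ * (1 - r₀)) = 0 := by
      have : (s₀ - r₀) * μ = r₀ * (1 - r₀) * z * (1 - μ) := by
        apply mul_right_cancel₀ hbr.ne'
        linear_combination hcrit
      field_simp
      linear_combination this
    rw [h0] at h
    have hp := hfpos z
    rw [hgr] at hp
    exact (mul_eq_zero.1 h.symm).resolve_left hp.ne'
  obtain ⟨hneg, hpos⟩ := sign_criticalFun ha hμ0 hμ1 hbr hzero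
  let K : ℝ → ℝ := fun b => 1 / μ * (ent a (gibbs a b) - ent a (gibbs a (μ * b)))
    + (gibbs a (μ * b) - gibbs a b) * b
  have hK : ∀ b, HasDerivAt K (gibbs a (μ * b) - gibbs a b
      - (1 / μ - 1) * b * (gibbs a b * (1 - gibbs a b))) b := by
    intro b
    have hlin : HasDerivAt (fun b => μ * b) μ b := by
      simpa using (hasDerivAt_id b).const_mul μ
    have h1 := (hasDerivAt_ent_gibbs ha (μ * b)).comp b hlin
    have h2 := (hasDerivAt_gibbs ha (μ * b)).comp b hlin
    refine ((((hasDerivAt_ent_gibbs ha b).sub h1).const_mul (1 / μ)).add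
      ((h2.sub (hasDerivAt_gibbs ha b)).mul (hasDerivAt_id b))).congr_deriv ?_
    simp only [Pi.sub_apply, Function.comp_apply, id_eq]
    field_simp
    ring
  have hL : ∀ s r, 0 < r → r < 1 → bregman a s r - (1 / μ - 1) * (ent a s - ent a r) =
      K (invTemp a r) + 1 / μ * bregman a s (gibbs a (μ * invTemp a r)) := by
    intro s r hr0 hr1
    simp only [K, bregman, invTemp_gibbs ha, gibbs_invTemp ha hr0 hr1]
    field_simp
    ring
  refine ⟨1 / μ - 1, fun s hs r hr hsr => ?_⟩
  have hr1 : r < 1 := hr.2.trans_lt hR1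
  have hs1 : s < 1 := hs.2.trans_lt hR1
  have e₀ := hL s₀ r₀ hr₀.1 hr₀1
  rw [← hz, hgs, bregman_self, mul_zero, add_zero] at e₀
  have e := hL s r hr.1 hr1
  have hμ' : 0 < 1 / μ := by positivity
  suffices K z < K (invTemp a r) + 1 / μ * bregman a s (gibbs a (μ * invTemp a r)) by linarith
  by_cases hrr : r = r₀
  · have hss : s ≠ s₀ := fun h => hsr (by rw [h, hrr])
    rw [hrr, ← hz, hgs]
    have := mul_pos hμ' (bregman_pos ha hs.1 hs1.le hs₀.1 hs₀1 hss)
    linarith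
  · have h1 : K z < K (invTemp a r) := by
      refine lt_of_deriv_sign hK hbr (fun x hx hxz => ?_) (fun x hx => ?_)
        (invTemp_nonneg ha hr) fun h => hrr ?_
      · rw [hfactor]
        exact mul_neg_of_pos_of_neg (hfpos x) (hneg x hx hxz)
      · rw [hfactor]
        exact mul_pos (hfpos x) (hpos x hx)
      · rw [← gibbs_invTemp ha hr.1 hr1, h, hgr]
    have := mul_nonneg hμ'.le (bregman_nonneg ha hs.1 hs1.le
      (gibbs_pos ha (μ * invTemp a r)) (gibbs_lt_one ha _))
    linarith

/-- A boundary point `(0, r₀)` with `r₀` close enough to the maximiser of the entropy is the unique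
global minimiser of a Lagrangian. -/
lemma support_of_boundary (ha : 0 < a) {r₀ : ℝ} (hr₀ : r₀ ∈ Ioo 0 (a / (1 + a)))
    (hb : invTemp a r₀ * (1 - r₀) ≤ 1) :
    ∃ l : ℝ, ∀ s ∈ Icc 0 (a / (1 + a)), ∀ r ∈ Ioc 0 (a / (1 + a)), (s, r) ≠ (0, r₀) →
      bregman a 0 r₀ + l * (ent a s - ent a r - (ent a 0 - ent a r₀)) < bregman a s r := by
  have hR1 := maxWeight_lt_one ha
  have hr₀1 : r₀ < 1 := hr₀.2.trans hR1
  have hbr : 0 < invTemp a r₀ := invTemp_pos ha hr₀.1 hr₀.2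
  have hgr : gibbs a (invTemp a r₀) = r₀ := gibbs_invTemp ha hr₀.1 hr₀1
  set z := invTemp a r₀ with hz
  have hc : 0 < z * (1 - r₀) := mul_pos hbr (by linarith)
  obtain ⟨l, hl⟩ : ∃ l, l = (z * (1 - r₀))⁻¹ := ⟨_, rfl⟩
  have hl1 : 1 ≤ l := hl ▸ (one_le_inv₀ hc).2 hb
  have hlz : l * (z * (1 - gibbs a z)) = 1 := by rw [hgr, hl, inv_mul_cancel₀ hc.ne']
  let J : ℝ → ℝ := fun b => (1 - l) * ent a (gibbs a b) - gibbs a b * b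
  have hJ : ∀ b, HasDerivAt J (gibbs a b * (l * (b * (1 - gibbs a b)) - 1)) b := fun b =>
    (((hasDerivAt_ent_gibbs ha b).const_mul (1 - l)).sub
      ((hasDerivAt_gibbs ha b).mul (hasDerivAt_id b))).congr_deriv (by
        simp only [id_eq]
        ring)
  have hlt : ∀ x y, 0 < x → x < y →
      l * (x * (1 - gibbs a x)) < l * (y * (1 - gibbs a y)) := by
    intro x y hx hxy
    have h1 := gibbs_strictAnti ha hxy
    have h2 := gibbs_lt_one ha x
    exact mul_lt_mul_of_pos_left (mul_lt_mul hxy (by linarith) (by linarith) (by linarith))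
      (by linarith)
  have hL : ∀ s r, 0 < r → r < 1 → bregman a s r + l * (ent a s - ent a r) =
      J (invTemp a r) + (l - 1) * ent a s + s * invTemp a r := by
    intro s r hr0 hr1
    simp only [J, bregman, gibbs_invTemp ha hr0 hr1]
    ring
  refine ⟨-l, fun s hs r hr hsr => ?_⟩
  have hr1 : r < 1 := hr.2.trans_lt hR1
  have e₀ := hL 0 r₀ hr₀.1 hr₀1
  rw [← hz, ent_zero] at e₀
  have e := hL s r hr.1 hr1
  rw [ent_zero]
  have h1 : 0 ≤ (l - 1) * ent a s := mul_nonneg (by linarith) (ent_mem ha hs).1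
  suffices J z < J (invTemp a r) + (l - 1) * ent a s + s * invTemp a r by linarith
  by_cases hrr : r = r₀
  · have hss : 0 < s := lt_of_le_of_ne hs.1 fun h => hsr (by rw [← h, hrr])
    rw [hrr, ← hz]
    have := mul_pos hss hbr
    linarith
  · have h2 : J z < J (invTemp a r) := by
      refine lt_of_deriv_sign hJ hbr (fun x hx hxz => ?_) (fun x hx => ?_)
        (invTemp_nonneg ha hr) fun h => hrr ?_
      · have := hlt x z hx hxz
        exact mul_neg_of_pos_of_neg (gibbs_pos ha x) (by linarith)
      · have := hlt z x hbr hx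
        exact mul_pos (gibbs_pos ha x) (by linarith)
      · rw [← gibbs_invTemp ha hr.1 hr1, h, hgr]
    have := mul_nonneg hs.1 (invTemp_nonneg ha hr)
    linarith

lemma continuousOn_mul_invTemp (ha : 0 < a) :
    ContinuousOn (fun r => r * invTemp a r) (Ico 0 1) := by
  have h : ContinuousOn (fun r => r * (log (1 - r) + log a) - r * log r) (Ico 0 1) := by
    refine ContinuousOn.sub (continuousOn_id.mul (ContinuousOn.add ?_ continuousOn_const))
      continuous_mul_log.continuousOn
    exact ContinuousOn.log (by fun_prop) fun x hx => by linarith [hx.2]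
  refine h.congr fun r hr => ?_
  rcases hr.1.eq_or_lt with rfl | h0
  · simp
  · simp only [invTemp_eq ha h0 hr.2]
    ring

lemma continuousOn_mul_invTemp_sq (ha : 0 < a) :
    ContinuousOn (fun r => r * invTemp a r ^ 2) (Ico 0 1) := by
  have hA : ContinuousOn (fun r : ℝ => log (1 - r) + log a) (Ico 0 1) :=
    ContinuousOn.add (ContinuousOn.log (by fun_prop) fun x hx => by linarith [hx.2])
      continuousOn_const
  have hq : Continuous fun r => 4 * (√r * log √r) ^ 2 :=
    ((continuous_mul_log.comp continuous_sqrt).pow 2).const_mul 4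
  have h : ContinuousOn (fun r => r * (log (1 - r) + log a) ^ 2
      - 2 * (log (1 - r) + log a) * (r * log r) + 4 * (√r * log √r) ^ 2) (Ico 0 1) :=
    ((continuousOn_id.mul (hA.pow 2)).sub
      ((hA.const_mul 2).mul continuous_mul_log.continuousOn)).add hq.continuousOn
  refine h.congr fun r hr => ?_
  rcases hr.1.eq_or_lt with rfl | h0
  · simp
  · simp only [invTemp_eq ha h0 hr.2, log_sqrt hr.1, mul_pow, sq_sqrt hr.1]
    ring

lemma exists_critical_of_pos (ha : 0 < a) {Δ : ℝ} (hΔ0 : 0 < Δ) (hΔ : Δ < log (1 + a)) :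
    ∃ s ∈ Ioo 0 (a / (1 + a)), ∃ r ∈ Ioo 0 (a / (1 + a)), ent a s - ent a r = Δ ∧
      (s - r) * invTemp a s =
        r * (1 - r) * invTemp a r * (invTemp a r - invTemp a s) := by
  obtain ⟨g, hgc, hg, hpos, hlt, hg0, hgR⟩ := exists_inverse_ent ha
  have hR1 := maxWeight_lt_one ha
  have hI : ∀ v ∈ Icc 0 (log (1 + a) - Δ), v ∈ Icc 0 (log (1 + a)) ∧
      v + Δ ∈ Icc 0 (log (1 + a)) := fun v hv =>
    ⟨⟨hv.1, by linarith [hv.2]⟩, ⟨by linarith [hv.1], by linarith [hv.2]⟩⟩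
  let C : ℝ → ℝ → ℝ := fun s r => (s - r) * invTemp a s - (1 - r) * (r * invTemp a r ^ 2)
    + (1 - r) * (r * invTemp a r) * invTemp a s
  have hr : ContinuousOn g (Icc 0 (log (1 + a) - Δ)) := hgc.mono fun v hv => (hI v hv).1
  have hs : ContinuousOn (fun v => g (v + Δ)) (Icc 0 (log (1 + a) - Δ)) :=
    hgc.comp (by fun_prop) fun v hv => (hI v hv).2
  have hbs : ContinuousOn (fun v => invTemp a (g (v + Δ))) (Icc 0 (log (1 + a) - Δ)) :=
    (continuousOn_invTemp ha).comp hs fun v hv =>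
      ⟨hpos _ ⟨by linarith [hv.1], (hI v hv).2.2⟩, (hg _ (hI v hv).2).1.2.trans_lt hR1⟩
  have hmaps : MapsTo g (Icc 0 (log (1 + a) - Δ)) (Ico 0 1) := fun v hv =>
    ⟨(hg v (hI v hv).1).1.1, (hg v (hI v hv).1).1.2.trans_lt hR1⟩
  have hC : ContinuousOn (fun v => C (g (v + Δ)) (g v)) (Icc 0 (log (1 + a) - Δ)) :=
    (((hs.sub hr).mul hbs).sub ((continuousOn_const.sub hr).mul
      ((continuousOn_mul_invTemp_sq ha).comp hr hmaps))).add
      (((continuousOn_const.sub hr).mul ((continuousOn_mul_invTemp ha).comp hr hmaps)).mul hbs)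
  have hleft : 0 < C (g (0 + Δ)) (g 0) := by
    have h1 := hpos Δ ⟨hΔ0, hΔ.le⟩
    have := mul_pos h1 (invTemp_pos ha h1 (hlt Δ ⟨hΔ0.le, hΔ⟩))
    simpa [C, hg0] using this
  have hright : C (g (log (1 + a) - Δ + Δ)) (g (log (1 + a) - Δ)) < 0 := by
    have h1 := hpos (log (1 + a) - Δ) ⟨by linarith, by linarith⟩
    have h2 := hlt (log (1 + a) - Δ) ⟨by linarith, by linarith⟩
    have := mul_pos (sub_pos.2 (h2.trans hR1)) (mul_pos h1 (pow_pos (invTemp_pos ha h1 h2) 2))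
    simpa [C, hgR, invTemp_maxWeight ha] using this
  obtain ⟨v, hv, hv0⟩ := intermediate_value_Icc' (by linarith) hC ⟨hright.le, hleft.le⟩
  have hv0' : C (g (v + Δ)) (g v) = 0 := hv0
  have hvl : 0 < v := lt_of_le_of_ne hv.1 (by rintro rfl; exact hleft.ne' hv0')
  have hvr : v < log (1 + a) - Δ := lt_of_le_of_ne hv.2 (by rintro rfl; exact hright.ne hv0')
  obtain ⟨h1, h2⟩ := hI v hv
  refine ⟨g (v + Δ), ⟨hpos _ ⟨by linarith, h2.2⟩, hlt _ ⟨h2.1, by linarith⟩⟩, g v,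
    ⟨hpos _ ⟨hvl, h1.2⟩, hlt _ ⟨h1.1, by linarith⟩⟩, ?_, ?_⟩
  · rw [(hg _ h1).2, (hg _ h2).2]; ring
  · simp only [C] at hv0'
    linear_combination hv0'

lemma exists_critical_of_neg (ha : 0 < a) {Δ : ℝ} (hΔ0 : Δ < 0) (hΔ : -log (1 + a) < Δ)
    {ρ : ℝ} (hρ : ρ ∈ Ioo 0 (a / (1 + a))) (hρΔ : ent a ρ = -Δ)
    (hb : 1 < invTemp a ρ * (1 - ρ)) :
    ∃ s ∈ Ioo 0 (a / (1 + a)), ∃ r ∈ Ioo 0 (a / (1 + a)), ent a s - ent a r = Δ ∧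
      (s - r) * invTemp a s =
        r * (1 - r) * invTemp a r * (invTemp a r - invTemp a s) := by
  obtain ⟨g, hgc, hg, hpos, hlt, hg0, hgR⟩ := exists_inverse_ent ha
  have hR1 := maxWeight_lt_one ha
  have hI : ∀ u ∈ Icc 0 (log (1 + a) + Δ), u ∈ Icc 0 (log (1 + a)) ∧
      u - Δ ∈ Icc 0 (log (1 + a)) := fun v hv =>
    ⟨⟨hv.1, by linarith [hv.2]⟩, ⟨by linarith [hv.1], by linarith [hv.2]⟩⟩
  have hgρ : g (0 - Δ) = ρ := by
    have h := hg (0 - Δ) ⟨by linarith, by linarith⟩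
    exact (strictMonoOn_ent ha).injOn h.1 ⟨hρ.1.le, hρ.2.le⟩ (by rw [h.2, hρΔ]; ring)
  let C : ℝ → ℝ → ℝ := fun s r => invTemp a s * (s - r + r * (1 - r) * invTemp a r)
    - r * (1 - r) * invTemp a r ^ 2
  have hs : ContinuousOn g (Icc 0 (log (1 + a) + Δ)) := hgc.mono fun v hv => (hI v hv).1
  have hr : ContinuousOn (fun v => g (v - Δ)) (Icc 0 (log (1 + a) + Δ)) :=
    hgc.comp (by fun_prop) fun v hv => (hI v hv).2
  have hbr : ContinuousOn (fun v => invTemp a (g (v - Δ))) (Icc 0 (log (1 + a) + Δ)) :=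
    (continuousOn_invTemp ha).comp hr fun v hv =>
      ⟨hpos _ ⟨by linarith [hv.1], (hI v hv).2.2⟩, (hg _ (hI v hv).2).1.2.trans_lt hR1⟩
  have hbs : ContinuousOn (fun v => invTemp a (g v)) (Ioc 0 (log (1 + a) + Δ)) :=
    (continuousOn_invTemp ha).comp (hs.mono Ioc_subset_Icc_self) fun v hv =>
      ⟨hpos _ ⟨hv.1, by linarith [hv.2]⟩, (hg _ (hI v ⟨hv.1.le, hv.2⟩).1).1.2.trans_lt hR1⟩
  have hB : ContinuousOn (fun v => g v - g (v - Δ)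
      + g (v - Δ) * (1 - g (v - Δ)) * invTemp a (g (v - Δ))) (Icc 0 (log (1 + a) + Δ)) :=
    (hs.sub hr).add ((hr.mul (continuousOn_const.sub hr)).mul hbr)
  have hE : ContinuousOn (fun v => g (v - Δ) * (1 - g (v - Δ)) * invTemp a (g (v - Δ)) ^ 2)
      (Icc 0 (log (1 + a) + Δ)) :=
    (hr.mul (continuousOn_const.sub hr)).mul (hbr.pow 2)
  have hC : ContinuousOn (fun v => C (g v) (g (v - Δ))) (Ioc 0 (log (1 + a) + Δ)) :=
    (hbs.mul (hB.mono Ioc_subset_Icc_self)).sub (hE.mono Ioc_subset_Icc_self)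
  have hright : C (g (log (1 + a) + Δ)) (g (log (1 + a) + Δ - Δ)) < 0 := by
    have h1 := hpos (log (1 + a) + Δ) ⟨by linarith, by linarith⟩
    have h2 := hlt (log (1 + a) + Δ) ⟨by linarith, by linarith⟩
    have := mul_neg_of_pos_of_neg (invTemp_pos ha h1 h2) (sub_neg.2 h2)
    simpa [C, hgR, invTemp_maxWeight ha] using this
  have h0mem : (0 : ℝ) ∈ Icc 0 (log (1 + a) + Δ) := ⟨le_rfl, by linarith⟩
  have hfilter : 𝓝[Ioc 0 (log (1 + a) + Δ)] (0 : ℝ) = 𝓝[>] 0 :=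
    nhdsWithin_Ioc_eq_nhdsGT (by linarith)
  have hle : 𝓝[>] (0 : ℝ) ≤ 𝓝[Icc 0 (log (1 + a) + Δ)] 0 :=
    hfilter ▸ nhdsWithin_mono _ Ioc_subset_Icc_self
  have hIoc : ∀ᶠ v in 𝓝[>] (0 : ℝ), v ∈ Ioc 0 (log (1 + a) + Δ) :=
    hfilter ▸ eventually_mem_nhdsWithin
  have htop : Tendsto (fun v => C (g v) (g (v - Δ))) (𝓝[>] 0) atTop := by
    have hgt : Tendsto g (𝓝[>] 0) (𝓝[>] 0) := by
      refine tendsto_nhdsWithin_iff.2 ⟨?_, hIoc.mono fun v hv =>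
        hpos v ⟨hv.1, by linarith [hv.2]⟩⟩
      have := (hs 0 h0mem).tendsto.mono_left hle
      rwa [hg0] at this
    have hBt := (hB 0 h0mem).tendsto.mono_left hle
    have hEt := (hE 0 h0mem).tendsto.mono_left hle
    simp only [hg0, hgρ] at hBt hEt
    have hBpos : 0 < 0 - ρ + ρ * (1 - ρ) * invTemp a ρ := by
      have := mul_pos hρ.1 (sub_pos.2 hb)
      linarith
    exact ((((tendsto_invTemp_zero ha).comp hgt).atTop_mul_pos hBpos hBt).atTop_add
      hEt.neg).congr fun v => (sub_eq_add_neg _ _).symm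
  obtain ⟨u, hu0, hu⟩ := ((htop.eventually (eventually_gt_atTop 0)).and hIoc).exists
  have hsub : Icc u (log (1 + a) + Δ) ⊆ Ioc 0 (log (1 + a) + Δ) := fun v hv =>
    ⟨hu.1.trans_le hv.1, hv.2⟩
  obtain ⟨v, hv, hv0⟩ := intermediate_value_Icc' hu.2 (hC.mono hsub) ⟨hright.le, hu0.le⟩
  have hv0' : C (g v) (g (v - Δ)) = 0 := hv0
  have hvl : 0 < v := (hsub hv).1
  have hvr : v < log (1 + a) + Δ := lt_of_le_of_ne hv.2 (by rintro rfl; exact hright.ne hv0')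
  obtain ⟨h1, h2⟩ := hI v ⟨hvl.le, hv.2⟩
  refine ⟨g v, ⟨hpos _ ⟨hvl, h1.2⟩, hlt _ ⟨h1.1, by linarith⟩⟩, g (v - Δ),
    ⟨hpos _ ⟨by linarith, h2.2⟩, hlt _ ⟨h2.1, by linarith⟩⟩, ?_, ?_⟩
  · rw [(hg _ h1).2, (hg _ h2).2]; ring
  · simp only [C] at hv0'
    linear_combination hv0'

/-- For every entropy difference in the open interval there is a point attaining it together with a
line that supports the relative entropy there, strictly at all other entropy differences. -/
lemma exists_support (ha : 0 < a) {Δ : ℝ} (hΔ : Δ ∈ Ioo (-log (1 + a)) (log (1 + a))) :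
    ∃ s₀ ∈ Icc 0 (a / (1 + a)), ∃ r₀ ∈ Ioc 0 (a / (1 + a)), ent a s₀ - ent a r₀ = Δ ∧
      ∃ l : ℝ, ∀ s ∈ Icc 0 (a / (1 + a)), ∀ r ∈ Ioc 0 (a / (1 + a)),
        bregman a s₀ r₀ + l * (ent a s - ent a r - Δ) ≤ bregman a s r ∧
        (ent a s - ent a r ≠ Δ →
          bregman a s₀ r₀ + l * (ent a s - ent a r - Δ) < bregman a s r) := by
  have hR0 := maxWeight_pos ha
  have hR1 := maxWeight_lt_one ha
  have wrap : ∀ s₀ ∈ Icc 0 (a / (1 + a)), ∀ r₀ ∈ Ioc 0 (a / (1 + a)), ent a s₀ - ent a r₀ = Δ →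
      (∃ l : ℝ, ∀ s ∈ Icc 0 (a / (1 + a)), ∀ r ∈ Ioc 0 (a / (1 + a)), (s, r) ≠ (s₀, r₀) →
        bregman a s₀ r₀ + l * (ent a s - ent a r - (ent a s₀ - ent a r₀)) < bregman a s r) →
      ∃ s₀ ∈ Icc 0 (a / (1 + a)), ∃ r₀ ∈ Ioc 0 (a / (1 + a)), ent a s₀ - ent a r₀ = Δ ∧
      ∃ l : ℝ, ∀ s ∈ Icc 0 (a / (1 + a)), ∀ r ∈ Ioc 0 (a / (1 + a)),
        bregman a s₀ r₀ + l * (ent a s - ent a r - Δ) ≤ bregman a s r ∧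
        (ent a s - ent a r ≠ Δ →
          bregman a s₀ r₀ + l * (ent a s - ent a r - Δ) < bregman a s r) := by
    rintro s₀ hs₀ r₀ hr₀ h ⟨l, hl⟩
    refine ⟨s₀, hs₀, r₀, hr₀, h, l, fun s hs r hr => ?_⟩
    rw [h] at hl
    by_cases heq : (s, r) = (s₀, r₀)
    · obtain ⟨rfl, rfl⟩ := Prod.mk.inj heq
      exact ⟨by rw [h]; simp, fun hne => absurd h hne⟩
    · exact ⟨(hl s hs r hr heq).le, fun _ => hl s hs r hr heq⟩
  rcases lt_trichotomy Δ 0 with h0 | rfl | h0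
  · obtain ⟨g, -, hg, hpos, hlt, -, -⟩ := exists_inverse_ent ha
    have hρΔ := (hg (-Δ) ⟨by linarith, by linarith [hΔ.1]⟩).2
    have hρ : g (-Δ) ∈ Ioo 0 (a / (1 + a)) :=
      ⟨hpos _ ⟨by linarith, by linarith [hΔ.1]⟩, hlt _ ⟨by linarith, by linarith [hΔ.1]⟩⟩
    rcases le_or_gt (invTemp a (g (-Δ)) * (1 - g (-Δ))) 1 with hb | hb
    · exact wrap 0 ⟨le_rfl, hR0.le⟩ _ ⟨hρ.1, hρ.2.le⟩ (by rw [ent_zero, hρΔ]; ring)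
        (support_of_boundary ha hρ hb)
    · obtain ⟨s, hs, r, hr, h, hc⟩ := exists_critical_of_neg ha h0 hΔ.1 hρ hρΔ hb
      exact wrap s ⟨hs.1.le, hs.2.le⟩ r ⟨hr.1, hr.2.le⟩ h
        (support_of_critical ha hs hr (by rintro rfl; linarith) hc)
  · refine ⟨_, ⟨hR0.le, le_rfl⟩, _, ⟨hR0, le_rfl⟩, sub_self _, 0, fun s hs r hr => ?_⟩
    rw [bregman_self, zero_mul, add_zero]
    have hs1 := hs.2.trans hR1.le
    have hr1 := hr.2.trans_lt hR1
    exact ⟨bregman_nonneg ha hs.1 hs1 hr.1 hr1, fun hne => bregman_pos ha hs.1 hs1 hr.1 hr1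
      (by rintro rfl; exact hne (sub_self _))⟩
  · obtain ⟨s, hs, r, hr, h, hc⟩ := exists_critical_of_pos ha h0 hΔ.2
    exact wrap s ⟨hs.1.le, hs.2.le⟩ r ⟨hr.1, hr.2.le⟩ h
      (support_of_critical ha hs hr (by rintro rfl; linarith) hc)

variable {d : ℕ}

lemma Mfun_le (ha : 0 < a) (had : (d : ℝ) = 1 + a) {s r : ℝ} (hs : s ∈ Icc 0 (a / (1 + a)))
    (hr : r ∈ Ioc 0 (a / (1 + a))) :
    Mfun (ent a s - ent a r) d ≤ ENNReal.ofReal (bregman a s r) := by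
  have hR1 := maxWeight_lt_one ha
  refine sInf_le ⟨s, r, ?_, ?_, ?_, ?_⟩
  · rwa [had, add_sub_cancel_left]
  · rw [had, add_sub_cancel_left]
    exact ⟨hr.1.le, hr.2⟩
  · rw [had, add_sub_cancel_left, ent, ent]
    ring
  · exact (binRelEntropy_eq ha hs.1 (hs.2.trans_lt hR1) hr.1 (hr.2.trans_lt hR1)).symm

/-- In the infimum defining `Mfun` only the pairs with positive second entry matter. -/
lemma le_Mfun (ha : 0 < a) (had : (d : ℝ) = 1 + a) {Δ : ℝ} {m : ℝ≥0∞}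
    (hm : ∀ s ∈ Icc 0 (a / (1 + a)), ∀ r ∈ Ioc 0 (a / (1 + a)), ent a s - ent a r = Δ →
      m ≤ ENNReal.ofReal (bregman a s r)) : m ≤ Mfun Δ d := by
  have hR0 := maxWeight_pos ha
  have hR1 := maxWeight_lt_one ha
  refine le_sInf ?_
  rintro _ ⟨s, r, hs, hr, h, rfl⟩
  rw [had, add_sub_cancel_left] at hs hr h
  have hΔ : ent a s - ent a r = Δ := by
    rw [← h, ent, ent]
    ring
  rcases hr.1.eq_or_lt with rfl | hr0
  · rcases hs.1.eq_or_lt with rfl | hs0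
    · have := hm _ ⟨hR0.le, le_rfl⟩ _ ⟨hR0, le_rfl⟩ (by rw [← hΔ, sub_self, sub_self])
      rw [bregman_self, ENNReal.ofReal_zero] at this
      exact this.trans zero_le
    · rw [binRelEntropy, if_pos (Or.inl ⟨rfl, hs0⟩)]
      exact le_top
  · rw [binRelEntropy_eq ha hs.1 (hs.2.trans_lt hR1) hr0 (hr.2.trans_lt hR1)]
    exact hm s hs r ⟨hr0, hr.2⟩ hΔ

lemma toReal_Mfun_eq (ha : 0 < a) (had : (d : ℝ) = 1 + a) {s₀ r₀ : ℝ}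
    (hs₀ : s₀ ∈ Icc 0 (a / (1 + a))) (hr₀ : r₀ ∈ Ioc 0 (a / (1 + a)))
    (hmin : ∀ s ∈ Icc 0 (a / (1 + a)), ∀ r ∈ Ioc 0 (a / (1 + a)),
      ent a s - ent a r = ent a s₀ - ent a r₀ → bregman a s₀ r₀ ≤ bregman a s r) :
    (Mfun (ent a s₀ - ent a r₀) d).toReal = bregman a s₀ r₀ := by
  have hR1 := maxWeight_lt_one ha
  rw [le_antisymm (Mfun_le ha had hs₀ hr₀) (le_Mfun ha had fun s hs r hr h =>
    ENNReal.ofReal_le_ofReal (hmin s hs r hr h)), ENNReal.toReal_ofReal]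
  exact bregman_nonneg ha hs₀.1 (hs₀.2.trans hR1.le) hr₀.1 (hr₀.2.trans_lt hR1)

/-- The infimum defining `Mfun` is attained. -/
lemma exists_toReal_Mfun_eq (ha : 0 < a) (had : (d : ℝ) = 1 + a) {Δ : ℝ}
    (hΔ : Δ ∈ Ico (-log (1 + a)) (log (1 + a))) :
    ∃ s ∈ Icc 0 (a / (1 + a)), ∃ r ∈ Ioc 0 (a / (1 + a)), ent a s - ent a r = Δ ∧
      (Mfun Δ d).toReal = bregman a s r := by
  have hR0 := maxWeight_pos ha
  rcases hΔ.1.eq_or_lt with rfl | h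
  · have h0 : (0 : ℝ) ∈ Icc 0 (a / (1 + a)) := ⟨le_rfl, hR0.le⟩
    have hR : a / (1 + a) ∈ Icc 0 (a / (1 + a)) := ⟨hR0.le, le_rfl⟩
    have hdiff : ent a 0 - ent a (a / (1 + a)) = -log (1 + a) := by
      rw [ent_zero, ent_maxWeight ha, zero_sub]
    refine ⟨0, h0, _, ⟨hR0, le_rfl⟩, hdiff, ?_⟩
    rw [← hdiff]
    refine toReal_Mfun_eq ha had h0 ⟨hR0, le_rfl⟩ fun s hs r hr h => ?_
    have hr' : r ∈ Icc 0 (a / (1 + a)) := ⟨hr.1.le, hr.2⟩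
    have h1 := (ent_mem ha hs).1
    have h2 := (ent_mem ha hr').2
    rw [hdiff] at h
    have hs0 : s = 0 := (strictMonoOn_ent ha).injOn hs h0 (by rw [ent_zero]; linarith)
    have hrR : r = a / (1 + a) :=
      (strictMonoOn_ent ha).injOn hr' hR (by rw [ent_maxWeight ha]; linarith)
    rw [hs0, hrR]
  · obtain ⟨s₀, hs₀, r₀, hr₀, rfl, l, hl⟩ := exists_support ha ⟨h, hΔ.2⟩
    refine ⟨s₀, hs₀, r₀, hr₀, rfl, toReal_Mfun_eq ha had hs₀ hr₀ fun s hs r hr h => ?_⟩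
    have := (hl s hs r hr).1
    rwa [h, sub_self, mul_zero, add_zero] at this

/-- At every interior entropy difference the graph of `Mfun` lies strictly above a line through its
point there. -/
lemma exists_supportingLine (ha : 0 < a) (had : (d : ℝ) = 1 + a) {Δ : ℝ}
    (hΔ : Δ ∈ Ioo (-log (1 + a)) (log (1 + a))) :
    ∃ l : ℝ, ∀ Δ' ∈ Ico (-log (1 + a)) (log (1 + a)), Δ' ≠ Δ →
      (Mfun Δ d).toReal + l * (Δ' - Δ) < (Mfun Δ' d).toReal := by
  obtain ⟨s₀, hs₀, r₀, hr₀, rfl, l, hl⟩ := exists_support ha hΔ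
  refine ⟨l, fun Δ' hΔ' hne => ?_⟩
  obtain ⟨s, hs, r, hr, rfl, hM⟩ := exists_toReal_Mfun_eq ha had hΔ'
  rw [hM, toReal_Mfun_eq ha had hs₀ hr₀ fun s hs r hr h => ?_]
  · exact (hl s hs r hr).2 hne
  · have := (hl s hs r hr).1
    rwa [h, sub_self, mul_zero, add_zero] at this

lemma strictConvexOn_toReal_Mfun (ha : 0 < a) (had : (d : ℝ) = 1 + a) :
    StrictConvexOn ℝ (Ico (-log (1 + a)) (log (1 + a))) fun Δ => (Mfun Δ d).toReal := by
  refine ⟨convex_Ico _ _, fun x hx y hy hxy p q hp hq hpq => ?_⟩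
  have hq' : q = 1 - p := by linarith
  subst hq'
  simp only [smul_eq_mul]
  have hzx : p * x + (1 - p) * y - x = (1 - p) * (y - x) := by ring
  have hzy : p * x + (1 - p) * y - y = p * (x - y) := by ring
  have hne1 : x ≠ p * x + (1 - p) * y := fun h => by
    rw [← h, sub_self] at hzx
    exact (mul_ne_zero hq.ne' (sub_ne_zero.2 hxy.symm)) hzx.symm
  have hne2 : y ≠ p * x + (1 - p) * y := fun h => by
    rw [← h, sub_self] at hzy
    exact (mul_ne_zero hp.ne' (sub_ne_zero.2 hxy)) hzy.symm
  have hmem : p * x + (1 - p) * y ∈ Ico (-log (1 + a)) (log (1 + a)) :=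
    convex_Ico _ _ hx hy hp.le hq.le hpq
  have hlow : -log (1 + a) < p * x + (1 - p) * y := by
    refine lt_of_le_of_ne hmem.1 fun h => ?_
    have h1 := mul_nonneg hp.le (sub_nonneg.2 hx.1)
    have h2 := mul_nonneg hq.le (sub_nonneg.2 hy.1)
    have h3 : p * (x - -log (1 + a)) = 0 := by linarith
    have h4 : (1 - p) * (y - -log (1 + a)) = 0 := by linarith
    have h5 := (mul_eq_zero.1 h3).resolve_left hp.ne'
    have h6 := (mul_eq_zero.1 h4).resolve_left hq.ne'
    exact hxy (by linarith)
  obtain ⟨l, hl⟩ := exists_supportingLine ha had ⟨hlow, hmem.2⟩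
  have h1 := mul_lt_mul_of_pos_left (hl x hx hne1) hp
  have h2 := mul_lt_mul_of_pos_left (hl y hy hne2) hq
  linarith

lemma continuousWithinAt_toReal_Mfun_left (ha : 0 < a) (had : (d : ℝ) = 1 + a) :
    ContinuousWithinAt (fun Δ => (Mfun Δ d).toReal) (Ico (-log (1 + a)) (log (1 + a)))
      (-log (1 + a)) := by
  obtain ⟨g, hgc, hg, hpos, -, -, hgR⟩ := exists_inverse_ent ha
  have hR0 := maxWeight_pos ha
  have hR1 := maxWeight_lt_one ha
  have hlog : 0 < log (1 + a) := log_pos (by linarith)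
  have hbound : ∀ x ∈ Ico (-log (1 + a)) 0,
      -x - invTemp a (g (-x)) ≤ (Mfun x d).toReal ∧ (Mfun x d).toReal ≤ -x := by
    intro x hx
    obtain ⟨s, hs, r, hr, h, hM⟩ := exists_toReal_Mfun_eq ha had ⟨hx.1, hx.2.trans hlog⟩
    have hr' : r ∈ Icc 0 (a / (1 + a)) := ⟨hr.1.le, hr.2⟩
    have hβ := invTemp_nonneg ha hr
    have hM' : (Mfun x d).toReal = -x + (s - r) * invTemp a r := by
      rw [hM, bregman, ← h]; ring
    obtain ⟨h1, h2⟩ := hg (-x) ⟨by linarith [hx.2], by linarith [hx.1]⟩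
    have hle := invTemp_le_invTemp ha (hpos (-x) ⟨by linarith [hx.2], by linarith [hx.1]⟩)
      (le_of_ent_le ha h1 hr' (by rw [h2]; linarith [(ent_mem ha hs).1])) (hr.2.trans_lt hR1)
    have hsr : s ≤ r := le_of_ent_le ha hs hr' (by linarith [hx.2])
    rw [hM']
    constructor
    · have : -1 * invTemp a r ≤ (s - r) * invTemp a r :=
        mul_le_mul_of_nonneg_right (by linarith [hs.1, hr.2]) hβ
      linarith
    · linarith [mul_nonpos_of_nonpos_of_nonneg (sub_nonpos.2 hsr) hβ]
  have hmem : -log (1 + a) ∈ Ico (-log (1 + a)) 0 := ⟨le_rfl, by linarith⟩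
  have hneg : MapsTo (fun x => -x) (Ico (-log (1 + a)) 0) (Ioc 0 (log (1 + a))) := fun x hx =>
    ⟨neg_pos.2 hx.2, neg_le.1 hx.1⟩
  have hcont : ContinuousOn (fun x => -x - invTemp a (g (-x))) (Ico (-log (1 + a)) 0) :=
    continuousOn_neg.sub ((continuousOn_invTemp ha).comp
      ((hgc.mono Ioc_subset_Icc_self).comp continuousOn_neg hneg) fun x hx =>
        ⟨hpos _ (hneg hx), (hg _ (Ioc_subset_Icc_self (hneg hx))).1.2.trans_lt hR1⟩)
  have hlow := (hcont _ hmem).tendsto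
  simp only [neg_neg, hgR, invTemp_maxWeight ha, sub_zero] at hlow
  have hup : Tendsto (fun x : ℝ => -x) (𝓝[Ico (-log (1 + a)) 0] (-log (1 + a)))
      (𝓝 (log (1 + a))) := by
    have := (continuous_neg (G := ℝ)).tendsto (-log (1 + a))
    rw [neg_neg] at this
    exact this.mono_left nhdsWithin_le_nhds
  have hval : (Mfun (-log (1 + a)) d).toReal = log (1 + a) := by
    have := hbound _ hmem
    rw [neg_neg, hgR, invTemp_maxWeight ha, sub_zero] at this
    exact le_antisymm this.2 this.1
  have hfilter : 𝓝[Ico (-log (1 + a)) (log (1 + a))] (-log (1 + a))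
      = 𝓝[Ico (-log (1 + a)) 0] (-log (1 + a)) := by
    rw [nhdsWithin_Ico_eq_nhdsGE (by linarith), nhdsWithin_Ico_eq_nhdsGE (by linarith)]
  rw [ContinuousWithinAt, hval, hfilter]
  exact tendsto_of_tendsto_of_tendsto_of_le_of_le' hlow hup
    (eventually_mem_nhdsWithin.mono fun x hx => (hbound x hx).1)
    (eventually_mem_nhdsWithin.mono fun x hx => (hbound x hx).2)

lemma continuousOn_toReal_Mfun (ha : 0 < a) (had : (d : ℝ) = 1 + a) :
    ContinuousOn (fun Δ => (Mfun Δ d).toReal) (Ico (-log (1 + a)) (log (1 + a))) := by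
  intro x hx
  rcases hx.1.eq_or_lt with rfl | h
  · exact continuousWithinAt_toReal_Mfun_left ha had
  · have hint := (strictConvexOn_toReal_Mfun ha had).convexOn.continuousOn_interior
    rw [interior_Ico] at hint
    exact (hint.continuousAt (Ioo_mem_nhds h hx.2)).continuousWithinAt

lemma tendsto_Mfun_top (ha : 0 < a) (had : (d : ℝ) = 1 + a) :
    Tendsto (fun Δ => Mfun Δ d) (𝓝[<] (log (1 + a))) (𝓝 ⊤) := by
  obtain ⟨g, hgc, hg, hpos, -, hg0, hgR⟩ := exists_inverse_ent ha
  have hR0 := maxWeight_pos ha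
  have hR1 := maxWeight_lt_one ha
  have hlog : 0 < log (1 + a) := log_pos (by linarith)
  have hIoo : ∀ᶠ Δ in 𝓝[<] (log (1 + a)), Δ ∈ Ioo 0 (log (1 + a)) := Ioo_mem_nhdsLT hlog
  have hgΔ : Tendsto g (𝓝[<] (log (1 + a))) (𝓝 (a / (1 + a))) := by
    have := (hgc _ ⟨hlog.le, le_rfl⟩).tendsto.mono_left
      (nhdsWithin_mono _ Ioo_subset_Icc_self)
    rwa [nhdsWithin_Ioo_eq_nhdsLT hlog, hgR] at this
  have hsub : Tendsto (fun Δ => log (1 + a) - Δ) (𝓝[<] (log (1 + a)))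
      (𝓝[Icc 0 (log (1 + a))] 0) := by
    refine tendsto_nhdsWithin_iff.2 ⟨?_, hIoo.mono fun Δ hΔ => ⟨?_, ?_⟩⟩
    · have h : Continuous fun Δ => log (1 + a) - Δ := by fun_prop
      have := h.tendsto (log (1 + a))
      rw [sub_self] at this
      exact this.mono_left nhdsWithin_le_nhds
    · linarith [hΔ.2]
    · linarith [hΔ.1]
  have hρ : Tendsto (fun Δ => g (log (1 + a) - Δ)) (𝓝[<] (log (1 + a))) (𝓝[>] 0) := by
    refine tendsto_nhdsWithin_iff.2 ⟨?_, hIoo.mono fun Δ hΔ =>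
      hpos _ ⟨by linarith [hΔ.2], by linarith [hΔ.1]⟩⟩
    have := (hgc 0 ⟨le_rfl, hlog.le⟩).tendsto.comp hsub
    rwa [hg0] at this
  have hdiff : Tendsto (fun Δ => g Δ - g (log (1 + a) - Δ)) (𝓝[<] (log (1 + a)))
      (𝓝 (a / (1 + a))) := by
    simpa using hgΔ.sub (hρ.mono_right nhdsWithin_le_nhds)
  have htop : Tendsto (fun Δ => -Δ + (g Δ - g (log (1 + a) - Δ)) *
      invTemp a (g (log (1 + a) - Δ))) (𝓝[<] (log (1 + a))) atTop := by
    have hid : Tendsto (fun Δ : ℝ => -Δ) (𝓝[<] (log (1 + a))) (𝓝 (-log (1 + a))) :=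
      ((continuous_neg (G := ℝ)).tendsto _).mono_left nhdsWithin_le_nhds
    exact hid.add_atTop (hdiff.pos_mul_atTop hR0 ((tendsto_invTemp_zero ha).comp hρ))
  refine tendsto_nhds_top_mono (ENNReal.tendsto_ofReal_nhds_top.2 htop) ?_
  filter_upwards [hIoo, hdiff.eventually (eventually_gt_nhds hR0)] with Δ hΔ hd0
  refine le_Mfun ha had fun s hs r hr h => ENNReal.ofReal_le_ofReal ?_
  have hr' : r ∈ Icc 0 (a / (1 + a)) := ⟨hr.1.le, hr.2⟩
  have h1 := hg Δ ⟨hΔ.1.le, hΔ.2.le⟩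
  have h2 := hg (log (1 + a) - Δ) ⟨by linarith [hΔ.2], by linarith [hΔ.1]⟩
  have hgs : g Δ ≤ s := le_of_ent_le ha h1.1 hs (by linarith [(ent_mem ha hr').1])
  have hrg : r ≤ g (log (1 + a) - Δ) :=
    le_of_ent_le ha hr' h2.1 (by linarith [(ent_mem ha hs).2])
  have hβ := invTemp_le_invTemp ha hr.1 hrg (h2.1.2.trans_lt hR1)
  have hβ0 := invTemp_nonneg ha ⟨hr.1.trans_le hrg, h2.1.2⟩
  have := mul_le_mul (show g Δ - g (log (1 + a) - Δ) ≤ s - r by linarith) hβ hβ0 (by linarith)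
  have hb : bregman a s r = -Δ + (s - r) * invTemp a r := by rw [bregman, ← h]; ring
  linarith

end EntropyGap

/-- continuity and strict convexity of `M(·,d)` on `[-log d, log d)`, and
divergence to `∞` as `Δ → log d`. -/
theorem Mfun_continuous_strictConvex (d : ℕ) (hd : 2 ≤ d) :
    ContinuousOn (fun Δ : ℝ => (Mfun Δ d).toReal) (Set.Ico (-Real.log d) (Real.log d)) ∧
    StrictConvexOn ℝ (Set.Ico (-Real.log d) (Real.log d)) (fun Δ : ℝ => (Mfun Δ d).toReal) ∧
    Filter.Tendsto (fun Δ : ℝ => Mfun Δ d)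
      (nhdsWithin (Real.log d) (Set.Iio (Real.log d))) (nhds ⊤) := by
  obtain ⟨a, had⟩ : ∃ a : ℝ, (d : ℝ) = 1 + a := ⟨d - 1, by ring⟩
  have ha : 0 < a := by
    have : (2 : ℝ) ≤ d := by exact_mod_cast hd
    linarith
  have hc := EntropyGap.continuousOn_toReal_Mfun ha had
  have hs := EntropyGap.strictConvexOn_toReal_Mfun ha had
  have ht := EntropyGap.tendsto_Mfun_top ha had
  rw [← had] at hc hs ht
  exact ⟨hc, hs, ht⟩

end
end

section
/- Let d ≥ 2 be an integer, let Θ be a nonempty finite set, and for each θ ∈ Θ let ρ^θ be a probability vector on Fin d. Let S_max and S_min be respectively the maximum and minimum of H(ρ^θ) over θ ∈ Θ, and set L = (log(d-1))² + 4. Then for every probability vector σ on Fin d there exists θ ∈ Θ such that D(ρ^θ‖σ) ≥ (S_max - S_min)²/(2L) - (S_max - S_min)³/(3L²) (an inequality in [0,∞]). -/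
open scoped ENNReal BigOperators

noncomputable section

/-- The variance of `log q` under a weight vector `q`. -/
def varentropy {ι : Type*} [Fintype ι] (q : ι → ℝ) : ℝ :=
  ∑ i, q i * Real.log (q i) ^ 2 - (∑ i, q i * Real.log (q i)) ^ 2

lemma continuousOn_mul_log_sq : ContinuousOn (fun x : ℝ => x * Real.log x ^ 2) (Set.Ici 0) := by
  have h : Continuous fun x : ℝ => 4 * (√x * Real.log √x) ^ 2 :=
    continuous_const.mul ((Real.continuous_mul_log.comp Real.continuous_sqrt).pow 2)
  refine h.continuousOn.congr fun x hx => ?_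
  have hx : 0 ≤ x := hx
  simp only [Real.log_sqrt hx, mul_pow, Real.sq_sqrt hx]
  ring

lemma continuousOn_varentropy {ι : Type*} [Fintype ι] :
    ContinuousOn (varentropy (ι := ι)) (stdSimplex ℝ ι) := by
  refine ContinuousOn.sub (continuousOn_finsetSum _ fun i _ => ?_) (ContinuousOn.pow ?_ 2)
  · exact continuousOn_mul_log_sq.comp (continuous_apply i).continuousOn fun q hq => hq.1 i
  · exact (continuous_finsetSum _ fun i _ =>
      Real.continuous_mul_log.comp (continuous_apply i)).continuousOn

lemma hasDerivAt_mul_log_sq {x : ℝ} (hx : x ≠ 0) :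
    HasDerivAt (fun y : ℝ => y * Real.log y ^ 2) (Real.log x ^ 2 + 2 * Real.log x) x := by
  have h := (hasDerivAt_id x).mul ((Real.hasDerivAt_log hx).pow 2)
  refine h.congr_deriv ?_
  simp only [id, Pi.pow_apply]
  field_simp
  ring

/-- First-order condition for a maximizer of the varentropy on the simplex. -/
lemma sum_eq_zero_of_isMaxOn_varentropy {ι : Type*} [Fintype ι] {q c : ι → ℝ}
    (hq : q ∈ stdSimplex ℝ ι) (hmax : IsMaxOn varentropy (stdSimplex ℝ ι) q)
    (hc : ∀ i, q i = 0 → c i = 0) (hc0 : ∑ i, c i = 0) :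
    ∑ i, c i * (Real.log (q i) ^ 2 + 2 * Real.log (q i)) -
      2 * (∑ i, q i * Real.log (q i)) * ∑ i, c i * Real.log (q i) = 0 := by
  have hline : ∀ i, HasDerivAt (fun s : ℝ => q i + s * c i) (c i) 0 := fun i => by
    simpa using ((hasDerivAt_id (0 : ℝ)).mul_const (c i)).const_add (q i)
  have hd : ∀ (f : ℝ → ℝ) (f' : ℝ → ℝ), (∀ x ≠ 0, HasDerivAt f (f' x) x) → ∀ i,
      HasDerivAt (fun s : ℝ => f (q i + s * c i)) (c i * f' (q i)) 0 := fun f f' hf i => by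
    by_cases hi : q i = 0
    · simpa [hc i hi] using hasDerivAt_const (0 : ℝ) (f (q i))
    · have h := HasDerivAt.comp (0 : ℝ) (h₂ := f) (h₂' := f' (q i)) (by simpa using hf _ hi) (hline i)
      exact h.congr_deriv (mul_comm _ _)
  have h1 := HasDerivAt.fun_sum (u := Finset.univ) fun i _ =>
    hd _ _ (fun x hx => hasDerivAt_mul_log_sq hx) i
  have h2 := HasDerivAt.fun_sum (u := Finset.univ) fun i _ =>
    hd _ _ (fun x hx => Real.hasDerivAt_mul_log hx) i
  have hV : HasDerivAt (fun s : ℝ => varentropy fun i => q i + s * c i) _ 0 := h1.sub (h2.pow 2)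
  have hloc : IsLocalMax (fun s : ℝ => varentropy fun i => q i + s * c i) 0 := by
    have hev : ∀ᶠ s : ℝ in nhds 0, ∀ i, 0 ≤ q i + s * c i := by
      refine Filter.eventually_all.2 fun i => ?_
      by_cases hi : q i = 0
      · simp [hi, hc i hi]
      · have hpos : 0 < q i + (0 : ℝ) * c i := by simpa using (hq.1 i).lt_of_ne' hi
        exact ((hline i).continuousAt.eventually_const_lt hpos).mono fun s hs => hs.le
    filter_upwards [hev] with s hs
    have hmem : (fun i => q i + s * c i) ∈ stdSimplex ℝ ι :=
      ⟨hs, by rw [Finset.sum_add_distrib, ← Finset.mul_sum, hc0, hq.2]; ring⟩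
    simpa using hmax hmem
  have h0 := hloc.hasDerivAt_eq_zero hV
  simp only [zero_mul, add_zero, mul_add, mul_one, Finset.sum_add_distrib, hc0] at h0 ⊢
  norm_num at h0
  linarith

lemma sq_add_two_le_exp_add_exp_neg (x : ℝ) : x ^ 2 + 2 ≤ Real.exp x + Real.exp (-x) := by
  have h : (x / 2) ^ 2 ≤ Real.sinh (x / 2) ^ 2 := by
    rw [sq_le_sq, Real.abs_sinh]
    exact Real.self_le_sinh_iff.2 (abs_nonneg _)
  have h2 : Real.exp x + Real.exp (-x) = 4 * Real.sinh (x / 2) ^ 2 + 2 := by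
    have e1 : Real.exp x = Real.exp (x / 2) ^ 2 := by rw [← Real.exp_nat_mul]; congr 1; push_cast; ring
    have e2 : Real.exp (-x) = Real.exp (-(x / 2)) ^ 2 := by
      rw [← Real.exp_nat_mul]; congr 1; push_cast; ring
    have e3 : Real.exp (x / 2) * Real.exp (-(x / 2)) = 1 := by rw [← Real.exp_add]; simp
    rw [Real.sinh_eq, e1, e2]
    linear_combination 2 * e3
  linarith

lemma mul_mul_log_div_add_sq_le {P Q : ℝ} (hP : 0 < P) (hQ : 0 < Q) (h : P + Q = 1) (l : ℝ) :
    P * Q * (Real.log (P / Q) + l) ^ 2 ≤ l ^ 2 / 4 + 1 := by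
  set y := Real.log (P / Q)
  have h1 : P * Q * (y ^ 2 + 4) ≤ 1 := by
    have hy := sq_add_two_le_exp_add_exp_neg y
    rw [Real.exp_neg, Real.exp_log (by positivity)] at hy
    have h2 : P * Q * (P / Q + (P / Q)⁻¹) = P ^ 2 + Q ^ 2 := by field_simp
    have h3 := mul_le_mul_of_nonneg_left hy (mul_pos hP hQ).le
    nlinarith
  have hcs : (y + l) ^ 2 ≤ (y ^ 2 + 4) * (l ^ 2 / 4 + 1) := by nlinarith [sq_nonneg (y * l - 4)]
  calc P * Q * (y + l) ^ 2 ≤ P * Q * ((y ^ 2 + 4) * (l ^ 2 / 4 + 1)) := by gcongr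
    _ = (P * Q * (y ^ 2 + 4)) * (l ^ 2 / 4 + 1) := by ring
    _ ≤ 1 * (l ^ 2 / 4 + 1) := by gcongr
    _ = _ := one_mul _

lemma log_natCast_div_sq_le {m n d : ℕ} (hm : 0 < m) (hn : 0 < n) (h : m + n ≤ d) :
    Real.log ((n : ℝ) / m) ^ 2 ≤ Real.log ((d : ℝ) - 1) ^ 2 := by
  have hm' : (1 : ℝ) ≤ m := by exact_mod_cast hm
  have hn' : (1 : ℝ) ≤ n := by exact_mod_cast hn
  have hd : (m : ℝ) + n ≤ d := by exact_mod_cast h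
  rw [Real.log_div (by positivity) (by positivity), sq_le_sq]
  have a1 := Real.log_nonneg hm'
  have a2 := Real.log_nonneg hn'
  have b1 : Real.log m ≤ Real.log ((d : ℝ) - 1) := Real.log_le_log (by linarith) (by linarith)
  have b2 : Real.log n ≤ Real.log ((d : ℝ) - 1) := Real.log_le_log (by linarith) (by linarith)
  exact (abs_le.2 ⟨by linarith, by linarith⟩).trans (le_abs_self _)

/-- At a maximizer of the varentropy, the positive weights take at most two values. -/
lemma log_eq_or_log_eq_of_isMaxOn_varentropy {ι : Type*} [Fintype ι] {q : ι → ℝ}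
    (hq : q ∈ stdSimplex ℝ ι) (hmax : IsMaxOn varentropy (stdSimplex ℝ ι) q) {i j k : ι}
    (hi : q i ≠ 0) (hj : q j ≠ 0) (hk : q k ≠ 0) (hij : Real.log (q i) ≠ Real.log (q j)) :
    Real.log (q k) = Real.log (q i) ∨ Real.log (q k) = Real.log (q j) := by
  classical
  have key : ∀ a b, q a ≠ 0 → q b ≠ 0 → Real.log (q a) ≠ Real.log (q b) →
      Real.log (q a) + Real.log (q b) = 2 * (∑ i, q i * Real.log (q i)) - 2 := by
    intro a b ha hb hab
    have h := sum_eq_zero_of_isMaxOn_varentropy (c := Pi.single a 1 - Pi.single b 1) hq hmax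
      (fun l hl => by
        have h1 : l ≠ a := by rintro rfl; exact ha hl
        have h2 : l ≠ b := by rintro rfl; exact hb hl
        simp [h1, h2])
      (by simp [Finset.sum_sub_distrib])
    simp only [Pi.sub_apply, sub_mul, Finset.sum_sub_distrib, Pi.single_apply, ite_mul, one_mul,
      zero_mul, Finset.sum_ite_eq', Finset.mem_univ, if_true] at h
    apply mul_left_cancel₀ (sub_ne_zero.2 hab)
    linear_combination h
  by_contra! hcon
  have e1 := key k i hk hi hcon.1
  have e2 := key k j hk hj hcon.2
  exact hij (by linarith)

lemma varentropy_le_of_two_values {ι : Type*} [Fintype ι] {q : ι → ℝ}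
    (hq : q ∈ stdSimplex ℝ ι) {i j : ι} (hi : q i ≠ 0) (hj : q j ≠ 0)
    (hij : Real.log (q i) ≠ Real.log (q j))
    (htwo : ∀ k, q k ≠ 0 → Real.log (q k) = Real.log (q i) ∨ Real.log (q k) = Real.log (q j)) :
    varentropy q ≤ Real.log ((Fintype.card ι : ℝ) - 1) ^ 2 / 4 + 1 := by
  classical
  have hpos : ∀ k, q k ≠ 0 → 0 < q k := fun k hk => (hq.1 k).lt_of_ne' hk
  have hne : q i ≠ q j := fun h => hij (by rw [h])
  have hval : ∀ k, q k = 0 ∨ q k = q i ∨ q k = q j := fun k => by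
    by_cases hk : q k = 0
    · exact Or.inl hk
    · exact Or.inr ((htwo k hk).imp (Real.log_injOn_pos (hpos k hk) (hpos i hi))
        (Real.log_injOn_pos (hpos k hk) (hpos j hj)))
  set A := Finset.univ.filter fun k => q k = q i with hA
  set B := Finset.univ.filter fun k => q k = q j with hB
  have hm : 0 < A.card := Finset.card_pos.2 ⟨i, by simp [hA]⟩
  have hn : 0 < B.card := Finset.card_pos.2 ⟨j, by simp [hB]⟩
  have hdisj : Disjoint A B := by
    rw [Finset.disjoint_left]
    intro k hkA hkB
    simp only [hA, hB, Finset.mem_filter, Finset.mem_univ, true_and] at hkA hkB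
    exact hne (hkA.symm.trans hkB)
  have hcard : A.card + B.card ≤ Fintype.card ι := by
    rw [← Finset.card_union_of_disjoint hdisj]
    exact Finset.card_le_univ _
  have hsum : ∀ f : ℝ → ℝ, f 0 = 0 → ∑ k, f (q k) = A.card * f (q i) + B.card * f (q j) := by
    intro f hf
    have h : ∀ k, f (q k) =
        (if q k = q i then f (q i) else 0) + if q k = q j then f (q j) else 0 := fun k => by
      rcases hval k with h | h | h
      · simp [h, hf, Ne.symm hi, Ne.symm hj]
      · simp [h, hne]
      · simp [h, hne.symm]
    rw [Finset.sum_congr rfl fun k _ => h k, Finset.sum_add_distrib, ← Finset.sum_filter,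
      ← Finset.sum_filter, Finset.sum_const, Finset.sum_const, nsmul_eq_mul, nsmul_eq_mul]
  have hPQ := (hsum id rfl).symm.trans hq.2
  simp only [id] at hPQ
  have hV : varentropy q = (A.card * q i) * (B.card * q j) *
      (Real.log (q i) - Real.log (q j)) ^ 2 := by
    rw [varentropy, hsum (fun x => x * Real.log x ^ 2) (by simp),
      hsum (fun x => x * Real.log x) (by simp)]
    linear_combination (-(A.card * q i * Real.log (q i) ^ 2 + B.card * q j * Real.log (q j) ^ 2)) *
      hPQ
  have hm' : (0 : ℝ) < A.card := by exact_mod_cast hm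
  have hn' : (0 : ℝ) < B.card := by exact_mod_cast hn
  have hqi := hpos i hi
  have hqj := hpos j hj
  have hlog : Real.log (q i) - Real.log (q j) =
      Real.log ((A.card * q i) / (B.card * q j)) + Real.log ((B.card : ℝ) / A.card) := by
    rw [← Real.log_div hi hj, ← Real.log_mul (by positivity) (by positivity)]
    congr 1
    field_simp
  rw [hV, hlog]
  have h1 := mul_mul_log_div_add_sq_le (mul_pos hm' hqi) (mul_pos hn' hqj) hPQ
    (Real.log ((B.card : ℝ) / A.card))
  have h2 := log_natCast_div_sq_le hm hn hcard
  linarith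

theorem varentropy_le {ι : Type*} [Fintype ι] {p : ι → ℝ} (hp : p ∈ stdSimplex ℝ ι) :
    varentropy p ≤ Real.log ((Fintype.card ι : ℝ) - 1) ^ 2 / 4 + 1 := by
  obtain ⟨q, hq, hmax⟩ := (isCompact_stdSimplex ℝ ι).exists_isMaxOn ⟨p, hp⟩ continuousOn_varentropy
  refine (hmax hp).trans ?_
  change varentropy q ≤ _
  by_cases h : ∃ i j, q i ≠ 0 ∧ q j ≠ 0 ∧ Real.log (q i) ≠ Real.log (q j)
  · obtain ⟨i, j, hi, hj, hij⟩ := h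
    exact varentropy_le_of_two_values hq hi hj hij fun k hk =>
      log_eq_or_log_eq_of_isMaxOn_varentropy hq hmax hi hj hk hij
  · push Not at h
    obtain ⟨i, hi⟩ : ∃ i, q i ≠ 0 := by
      by_contra! hall
      have := hq.2
      simp [hall] at this
    have hrep : ∀ f : ℝ → ℝ, ∑ k, q k * f (Real.log (q k)) = f (Real.log (q i)) := fun f => by
      rw [← one_mul (f (Real.log (q i))), ← hq.2, Finset.sum_mul]
      refine Finset.sum_congr rfl fun k _ => ?_
      by_cases hk : q k = 0
      · simp [hk]
      · rw [h k i hk hi]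
    have hz : varentropy q = 0 := by
      rw [varentropy, hrep (fun x => x ^ 2), hrep (fun x => x), sub_self]
    rw [hz]
    positivity

lemma hasDerivAt_const_rpow_mul {x : ℝ} (hx : 0 ≤ x) (c : ℝ) {t : ℝ} (ht : 0 < t) :
    HasDerivAt (fun s : ℝ => x ^ s * c) (x ^ t * (Real.log x * c)) t := by
  rcases hx.eq_or_lt with rfl | hx
  · have h : (fun s : ℝ => (0 : ℝ) ^ s * c) =ᶠ[nhds t] fun _ => 0 := by
      filter_upwards [eventually_gt_nhds ht] with s hs
      rw [Real.zero_rpow hs.ne', zero_mul]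
    simpa using (hasDerivAt_const t (0 : ℝ)).congr_of_eventuallyEq h
  · simpa [mul_assoc] using ((Real.hasStrictDerivAt_const_rpow hx t).hasDerivAt.mul_const c)

/-- Moments of `log σ` under the unnormalized power weights `σ ^ t`. -/
def powerMoment {d : ℕ} (σ : Fin d → ℝ) (n : ℕ) (t : ℝ) : ℝ :=
  ∑ i, σ i ^ t * Real.log (σ i) ^ n

lemma hasDerivAt_powerMoment {d : ℕ} {σ : Fin d → ℝ} (hσ : ∀ i, 0 ≤ σ i) (n : ℕ) {t : ℝ}
    (ht : 0 < t) : HasDerivAt (powerMoment σ n) (powerMoment σ (n + 1) t) t := by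
  have h := HasDerivAt.fun_sum (u := Finset.univ) fun i _ =>
    hasDerivAt_const_rpow_mul (hσ i) (Real.log (σ i) ^ n) ht
  simp only [← pow_succ'] at h
  exact h

lemma powerMoment_zero_pos {d : ℕ} {σ : Fin d → ℝ} (hσ : σ ∈ stdSimplex ℝ (Fin d)) (t : ℝ) :
    0 < powerMoment σ 0 t := by
  obtain ⟨i, hi⟩ : ∃ i, σ i ≠ 0 := by
    by_contra! hall
    have := hσ.2
    simp [hall] at this
  refine Finset.sum_pos' (fun j _ => ?_) ⟨i, Finset.mem_univ i, ?_⟩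
  · simpa using Real.rpow_nonneg (hσ.1 j) t
  · simpa using Real.rpow_pos_of_pos ((hσ.1 i).lt_of_ne' hi) t

lemma tilted_eq_zero_or_log_tilted {x t Z : ℝ} (hx : 0 ≤ x) (ht : 0 < t) (hZ : 0 < Z) :
    x = 0 ∧ x ^ t / Z = 0 ∨
      0 < x ^ t / Z ∧ Real.log (x ^ t / Z) = t * Real.log x - Real.log Z := by
  rcases hx.eq_or_lt with rfl | hx
  · exact Or.inl ⟨rfl, by rw [Real.zero_rpow ht.ne', zero_div]⟩
  · have := Real.rpow_pos_of_pos hx t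
    exact Or.inr ⟨by positivity, by rw [Real.log_div this.ne' hZ.ne', Real.log_rpow hx]⟩

lemma tilted_mem_stdSimplex {d : ℕ} {σ : Fin d → ℝ} (hσ : σ ∈ stdSimplex ℝ (Fin d)) (t : ℝ) :
    (fun i => σ i ^ t / powerMoment σ 0 t) ∈ stdSimplex ℝ (Fin d) := by
  have hZ := powerMoment_zero_pos hσ t
  refine ⟨fun i => div_nonneg (Real.rpow_nonneg (hσ.1 i) t) hZ.le, ?_⟩
  rw [← Finset.sum_div, div_eq_one_iff_eq hZ.ne']
  simp [powerMoment]

lemma varentropy_tilted {d : ℕ} {σ : Fin d → ℝ} (hσ : σ ∈ stdSimplex ℝ (Fin d)) {t : ℝ}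
    (ht : 0 < t) :
    varentropy (fun i => σ i ^ t / powerMoment σ 0 t) =
      t ^ 2 * (powerMoment σ 2 t / powerMoment σ 0 t -
        (powerMoment σ 1 t / powerMoment σ 0 t) ^ 2) := by
  have hZ := powerMoment_zero_pos hσ t
  set Z := powerMoment σ 0 t with hZdef
  have hmom : ∀ n, ∑ i, σ i ^ t / Z * Real.log (σ i) ^ n = powerMoment σ n t / Z := fun n => by
    rw [powerMoment, Finset.sum_div]
    exact Finset.sum_congr rfl fun i _ => by ring
  have h0 := hmom 0
  rw [← hZdef, div_self hZ.ne'] at h0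
  have h1 := hmom 1
  have h2 := hmom 2
  simp only [pow_zero, mul_one, pow_one] at h0 h1
  have e1 : ∑ i, σ i ^ t / Z * Real.log (σ i ^ t / Z) =
      t * ∑ i, σ i ^ t / Z * Real.log (σ i) - Real.log Z * ∑ i, σ i ^ t / Z := by
    simp only [Finset.mul_sum, ← Finset.sum_sub_distrib]
    refine Finset.sum_congr rfl fun i _ => ?_
    rcases tilted_eq_zero_or_log_tilted (hσ.1 i) ht hZ with h | h
    · simp [h.2]
    · rw [h.2]; ring
  have e2 : ∑ i, σ i ^ t / Z * Real.log (σ i ^ t / Z) ^ 2 =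
      t ^ 2 * ∑ i, σ i ^ t / Z * Real.log (σ i) ^ 2 -
        2 * t * Real.log Z * ∑ i, σ i ^ t / Z * Real.log (σ i) +
        Real.log Z ^ 2 * ∑ i, σ i ^ t / Z := by
    simp only [Finset.mul_sum, ← Finset.sum_sub_distrib, ← Finset.sum_add_distrib]
    refine Finset.sum_congr rfl fun i _ => ?_
    rcases tilted_eq_zero_or_log_tilted (hσ.1 i) ht hZ with h | h
    · simp [h.2]
    · rw [h.2]; ring
  rw [varentropy, e1, e2, h0, h1, h2]
  ring

/-- Tangent-line bound at `t = 1` for the log-partition function of the power family of `σ`. -/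
lemma log_powerMoment_le {d : ℕ} {σ : Fin d → ℝ} (hσ : σ ∈ stdSimplex ℝ (Fin d)) {t : ℝ}
    (ht : 0 < t) :
    Real.log (powerMoment σ 0 t) ≤
      (Real.log ((d : ℝ) - 1) ^ 2 / 4 + 1 - shEntropy σ) * (t - 1) -
        (Real.log ((d : ℝ) - 1) ^ 2 / 4 + 1) * Real.log t := by
  set N := Real.log ((d : ℝ) - 1) ^ 2 / 4 + 1
  have hZ := powerMoment_zero_pos hσ
  set g : ℝ → ℝ := fun s => Real.log (powerMoment σ 0 s) + N * Real.log s
  set g' : ℝ → ℝ := fun s => powerMoment σ 1 s / powerMoment σ 0 s + N * s⁻¹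
  have hg : ∀ s, 0 < s → HasDerivAt g (g' s) s := fun s hs =>
    ((hasDerivAt_powerMoment hσ.1 0 hs).log (hZ s).ne').add
      ((Real.hasDerivAt_log hs.ne').const_mul N)
  have hg' : ∀ s, 0 < s → HasDerivAt g'
      ((powerMoment σ 2 s * powerMoment σ 0 s - powerMoment σ 1 s * powerMoment σ 1 s) /
        powerMoment σ 0 s ^ 2 + N * -(s ^ 2)⁻¹) s := fun s hs =>
    ((hasDerivAt_powerMoment hσ.1 1 hs).div (hasDerivAt_powerMoment hσ.1 0 hs) (hZ s).ne').add
      ((hasDerivAt_inv hs.ne').const_mul N)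
  have hconc : ConcaveOn ℝ (Set.Ioi 0) g := by
    refine concaveOn_of_hasDerivWithinAt2_nonpos (convex_Ioi 0)
      (fun s hs => (hg s hs).continuousAt.continuousWithinAt)
      (fun s hs => (hg s (by simpa using hs)).hasDerivWithinAt)
      (fun s hs => (hg' s (by simpa using hs)).hasDerivWithinAt) fun s hs => ?_
    have hs : 0 < s := by simpa using hs
    have hv := varentropy_le (tilted_mem_stdSimplex hσ s)
    rw [varentropy_tilted hσ hs, Fintype.card_fin, ← le_div_iff₀' (by positivity)] at hv
    have hZs := (hZ s).ne'
    have heq : (powerMoment σ 2 s * powerMoment σ 0 s - powerMoment σ 1 s * powerMoment σ 1 s) /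
        powerMoment σ 0 s ^ 2 = powerMoment σ 2 s / powerMoment σ 0 s -
        (powerMoment σ 1 s / powerMoment σ 0 s) ^ 2 := by field_simp
    rw [heq, mul_neg, ← div_eq_mul_inv]
    linarith
  have hZ1 : powerMoment σ 0 1 = 1 := by simpa [powerMoment] using hσ.2
  have hM1 : powerMoment σ 1 1 = -shEntropy σ := by simp [powerMoment, shEntropy]
  have hg1 : g 1 = 0 := by simp [g, hZ1]
  have hg1' : g' 1 = N - shEntropy σ := by simp only [g', hZ1, hM1]; ring
  have hd1 := hg1' ▸ hg 1 one_pos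
  have htan : g t ≤ (N - shEntropy σ) * (t - 1) := by
    rcases lt_trichotomy t 1 with h | rfl | h
    · have := hconc.le_slope_of_hasDerivAt ht (Set.mem_Ioi.2 one_pos) h hd1
      rw [slope_def_field, hg1, le_div_iff₀ (by linarith)] at this
      linarith
    · simp [hg1]
    · have := hconc.slope_le_of_hasDerivAt (Set.mem_Ioi.2 one_pos) ht h hd1
      rw [slope_def_field, hg1, div_le_iff₀ (by linarith)] at this
      linarith
  simp only [g] at htan
  linarith

/-- Gibbs' inequality against the normalized power `σ ^ t`. -/
lemma mul_sum_mul_log_le {d : ℕ} {p σ : Fin d → ℝ} (hp : p ∈ stdSimplex ℝ (Fin d))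
    (hσ : σ ∈ stdSimplex ℝ (Fin d)) (hac : ∀ i, σ i = 0 → p i = 0) {t : ℝ} (ht : 0 < t) :
    t * ∑ i, p i * Real.log (σ i) ≤ Real.log (powerMoment σ 0 t) - shEntropy p := by
  have hZ := powerMoment_zero_pos hσ t
  set Z := powerMoment σ 0 t
  have hterm : ∀ i, p i * (t * Real.log (σ i) - Real.log Z) ≤
      p i * Real.log (p i) + (σ i ^ t / Z - p i) := fun i => by
    rcases tilted_eq_zero_or_log_tilted (hσ.1 i) ht hZ with h | ⟨hpos, hlog⟩
    · simp [hac i h.1, h.2]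
    · rcases (hp.1 i).eq_or_lt with h0 | h0
      · rw [← h0]; simpa using hpos.le
      · have h1 := Real.log_le_sub_one_of_pos (div_pos hpos h0)
        rw [Real.log_div hpos.ne' h0.ne', hlog] at h1
        have h2 := mul_le_mul_of_nonneg_left h1 h0.le
        have h3 : p i * (σ i ^ t / Z / p i - 1) = σ i ^ t / Z - p i := by field_simp
        linarith
  have hsum := Finset.sum_le_sum fun i (_ : i ∈ Finset.univ) => hterm i
  rw [Finset.sum_add_distrib, Finset.sum_sub_distrib, (tilted_mem_stdSimplex hσ t).2, hp.2] at hsum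
  have h1 : ∑ i, p i * (t * Real.log (σ i) - Real.log Z) =
      t * ∑ i, p i * Real.log (σ i) - Real.log Z := by
    have h : Real.log Z = ∑ i, Real.log Z * p i := by rw [← Finset.mul_sum, hp.2, mul_one]
    conv_rhs => rw [h, Finset.mul_sum, ← Finset.sum_sub_distrib]
    exact Finset.sum_congr rfl fun i _ => by ring
  have h2 : shEntropy p = -∑ i, p i * Real.log (p i) := by simp [shEntropy]
  linarith

lemma one_sub_add_sub_le_exp_neg {b : ℝ} (hb : 0 ≤ b) :
    1 - b + b ^ 2 / 2 - b ^ 3 / 6 ≤ Real.exp (-b) := by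
  have hd : ∀ x : ℝ, HasDerivAt
      (fun y : ℝ => Real.exp y * (1 - y + y ^ 2 / 2 - y ^ 3 / 6)) (-(Real.exp x * x ^ 3 / 6)) x := by
    intro x
    have h1 : HasDerivAt (fun y : ℝ => 1 - y + y ^ 2 / 2 - y ^ 3 / 6) (-1 + x - x ^ 2 / 2) x := by
      refine ((((hasDerivAt_id x).const_sub 1).add ((hasDerivAt_pow 2 x).div_const 2)).sub
        ((hasDerivAt_pow 3 x).div_const 6)).congr_deriv ?_
      norm_num
      ring
    exact ((Real.hasDerivAt_exp x).mul h1).congr_deriv (by ring)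
  have hanti := antitoneOn_of_hasDerivWithinAt_nonpos (convex_Ici (0 : ℝ))
    (fun x _ => (hd x).continuousAt.continuousWithinAt) (fun x _ => (hd x).hasDerivWithinAt)
    (fun x hx => by
      have hx : 0 < x := by simpa using hx
      exact neg_nonpos.2 (by positivity))
  have h := hanti (Set.mem_Ici.2 le_rfl) (Set.mem_Ici.2 hb) hb
  norm_num at h
  rw [Real.exp_neg, ← one_div, le_div_iff₀' (Real.exp_pos b)]
  exact h

/-- Lower bound on the relative entropy in terms of the entropy difference. -/
theorem le_sum_mul_log_div_of_le_abs {d : ℕ} {p σ : Fin d → ℝ} (hp : p ∈ stdSimplex ℝ (Fin d))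
    (hσ : σ ∈ stdSimplex ℝ (Fin d)) (hac : ∀ i, σ i = 0 → p i = 0) {a : ℝ} (ha : 0 ≤ a)
    (hdiff : a ≤ |shEntropy p - shEntropy σ|) :
    a ^ 2 / (2 * (Real.log ((d : ℝ) - 1) ^ 2 / 4 + 1)) -
        a ^ 3 / (6 * (Real.log ((d : ℝ) - 1) ^ 2 / 4 + 1) ^ 2) ≤
      ∑ i, p i * Real.log (p i / σ i) := by
  have htan := fun t (ht : 0 < t) => log_powerMoment_le hσ ht
  have hN : 0 < Real.log ((d : ℝ) - 1) ^ 2 / 4 + 1 := by positivity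
  set N := Real.log ((d : ℝ) - 1) ^ 2 / 4 + 1
  obtain ⟨b, rfl⟩ : ∃ b, a = N * b := ⟨a / N, by field_simp⟩
  have hb : 0 ≤ b := nonneg_of_mul_nonneg_right ha hN
  set D := ∑ i, p i * Real.log (p i / σ i) with hD
  have hDeq : D = -shEntropy p - ∑ i, p i * Real.log (σ i) := by
    rw [hD, shEntropy, ← Finset.sum_neg_distrib, ← Finset.sum_sub_distrib]
    refine Finset.sum_congr rfl fun i _ => ?_
    by_cases h0 : p i = 0
    · simp [h0]
    · rw [Real.log_div h0 fun h => h0 (hac i h)]; ring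
  have hlow : ∀ t, 0 < t →
      (1 - t) * (shEntropy p - shEntropy σ + N) + N * Real.log t ≤ t * D := fun t ht => by
    have h1 := mul_sum_mul_log_le hp hσ hac ht
    have h2 := htan t ht
    rw [hDeq]
    linarith
  have hgoal : (N * b) ^ 2 / (2 * N) - (N * b) ^ 3 / (6 * N ^ 2) = N * (b ^ 2 / 2 - b ^ 3 / 6) := by
    field_simp
  rw [hgoal]
  have he : Real.exp (-b) * Real.exp b = 1 := by rw [← Real.exp_add]; simp
  have hep := Real.exp_pos b
  rcases le_abs.1 hdiff with h | h
  · have h1 := hlow _ (Real.exp_pos (-b))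
    rw [Real.log_exp] at h1
    have h2 : 0 ≤ 1 - Real.exp (-b) := by simpa using hb
    have h3 := mul_le_mul_of_nonneg_left (add_le_add_left h N) h2
    have h4 := mul_le_mul_of_nonneg_left (h3.trans (by linarith :
      _ ≤ Real.exp (-b) * D - N * -b)) hep.le
    have h5 : N * (Real.exp b - 1 - b) ≤ D := by
      linear_combination h4 + (N * b + N + D) * he
    have h6 := Real.quadratic_le_exp_of_nonneg hb
    refine le_trans (mul_le_mul_of_nonneg_left ?_ hN.le) h5
    have := pow_nonneg hb 3
    linarith
  · have h1 := hlow _ hep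
    rw [Real.log_exp] at h1
    have h2 : 0 ≤ Real.exp b - 1 := by simpa using hb
    have h3 := mul_le_mul_of_nonneg_left (sub_le_sub_right h N) h2
    have h4 := mul_le_mul_of_nonneg_left (h3.trans (by linarith :
      _ ≤ Real.exp b * D - N * b)) (Real.exp_pos (-b)).le
    have h5 : N * (b - 1 + Real.exp (-b)) ≤ D := by
      linear_combination h4 + (N - N * b + D) * he
    have h6 := one_sub_add_sub_le_exp_neg hb
    refine le_trans (mul_le_mul_of_nonneg_left ?_ hN.le) h5
    linarith

/-- lower bound on the redundancy of any universal code. -/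
theorem redundancy_lower_bound {Θ : Type*} [Fintype Θ] [Nonempty Θ]
    (d : ℕ) (hd : 2 ≤ d) (ρ : Θ → Fin d → ℝ)
    (hρ0 : ∀ θ i, 0 ≤ ρ θ i) (hρ1 : ∀ θ, ∑ i, ρ θ i = 1)
    (Smax Smin : ℝ)
    (hmax : IsGreatest (Set.range fun θ => shEntropy (ρ θ)) Smax)
    (hmin : IsLeast (Set.range fun θ => shEntropy (ρ θ)) Smin)
    (σ : Fin d → ℝ) (hσ0 : ∀ i, 0 ≤ σ i) (hσ1 : ∑ i, σ i = 1) :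
    ∃ θ : Θ, ENNReal.ofReal
        ((Smax - Smin)^2 / (2 * ((Real.log ((d:ℝ) - 1))^2 + 4)) -
          (Smax - Smin)^3 / (3 * ((Real.log ((d:ℝ) - 1))^2 + 4)^2))
      ≤ relEntropy (ρ θ) σ := by
  have hσ : σ ∈ stdSimplex ℝ (Fin d) := ⟨hσ0, hσ1⟩
  have hΔ : Smin ≤ Smax := hmin.2 hmax.1
  obtain ⟨θ, hθ⟩ : ∃ θ, (Smax - Smin) / 2 ≤ |shEntropy (ρ θ) - shEntropy σ| := by
    obtain ⟨θ₁, h₁⟩ := hmax.1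
    obtain ⟨θ₂, h₂⟩ := hmin.1
    simp only at h₁ h₂
    rcases le_total (shEntropy σ) ((Smax + Smin) / 2) with h | h
    · exact ⟨θ₁, le_abs.2 (Or.inl (by linarith))⟩
    · exact ⟨θ₂, le_abs.2 (Or.inr (by linarith))⟩
  refine ⟨θ, ?_⟩
  rw [relEntropy]
  split_ifs with hac
  · refine ENNReal.ofReal_le_ofReal ?_
    have h := le_sum_mul_log_div_of_le_abs ⟨hρ0 θ, hρ1 θ⟩ hσ hac (by linarith) hθ
    convert h using 1
    field_simp
    ring
  · exact le_top

end
end
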